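/- arXiv:1502.00198 — 3 statements merged into one kernel-verified Lean document; each statement's English description precedes it below -/
import Mathlib

section
/- Let n ≥ 1 and k ≥ 0. Let f be a k-multilinear map on the space sl(n,ℂ) = {X : Matrix (Fin n) (Fin n) ℂ | tr X = 0} with values in ℂ, such that f(g X₁ g⁻¹, …, g X_k g⁻¹) = f(X₁, …, X_k) for every g in SL(n,ℂ) (invertible n×n complex matrices of determinant 1) and all traceless X₁,…,X_k. Then f lies in the ℂ-linear span of the restrictions to sl(n,ℂ) of the trace monomials T_σ, as σ ranges over all permutations of {1,…,k}. -/
open Finset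

lemma aux_dc {G I : Type*} [Group G] [Fintype G] [Fintype I] [DecidableEq I]
    (P : G →* Matrix I I ℂ) (T : Matrix I I ℂ)
    (hT : ∀ B : Matrix I I ℂ, (∀ g, P g * B = B * P g) → T * B = B * T) :
    T ∈ Submodule.span ℂ (Set.range P) := by
  classical
  set A := Submodule.span ℂ (Set.range P) with hA
  obtain ⟨q, hq⟩ := A.subtype.exists_leftInverse_of_injective (by simp)
  have hq' : ∀ a ∈ A, ((q a : A) : Matrix I I ℂ) = a := fun a ha => by
    have := LinearMap.congr_fun hq ⟨a, ha⟩
    simpa using congrArg Subtype.val this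
  have hmul : ∀ g, ∀ a ∈ A, P g * a ∈ A := by
    intro g a ha
    induction ha using Submodule.span_induction with
    | mem x hx =>
      obtain ⟨h, rfl⟩ := hx
      exact Submodule.subset_span ⟨g * h, by simp⟩
    | zero => simp
    | add x y _ _ hx hy => rw [mul_add]; exact A.add_mem hx hy
    | smul c x _ hx => rw [mul_smul_comm]; exact A.smul_mem _ hx
  let p : Matrix I I ℂ →ₗ[ℂ] Matrix I I ℂ :=
    (Fintype.card G : ℂ)⁻¹ • ∑ g : G, LinearMap.mulLeft ℂ (P g⁻¹) ∘ₗ A.subtype ∘ₗ q ∘ₗ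
      LinearMap.mulLeft ℂ (P g)
  have hp : ∀ X, p X = (Fintype.card G : ℂ)⁻¹ • ∑ g : G, P g⁻¹ * (q (P g * X) : Matrix I I ℂ) := by
    intro X; simp [p]
  have hp1 : p 1 = 1 := by
    rw [hp]
    have : ∀ g : G, P g⁻¹ * (q (P g * 1) : Matrix I I ℂ) = 1 := by
      intro g
      rw [hq' _ (by rw [mul_one]; exact Submodule.subset_span ⟨g, rfl⟩), mul_one, ← map_mul]
      simp
    simp only [this]
    simp [← Nat.cast_smul_eq_nsmul ℂ]
  have hpA : ∀ X, p X ∈ A := by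
    intro X
    rw [hp]
    exact A.smul_mem _ (A.sum_mem fun g _ => hmul _ _ (Subtype.mem _))
  have hpP : ∀ h X, p (P h * X) = P h * p X := by
    intro h X
    rw [hp, hp, mul_smul_comm, Finset.mul_sum]
    congr 1
    refine Fintype.sum_equiv (Equiv.mulRight h) _ _ fun g => ?_
    simp only [Equiv.coe_mulRight, map_mul, mul_inv_rev, ← mul_assoc]
    rw [← map_mul P h h⁻¹]
    simp
  have hlin : ∀ (X : Matrix I I ℂ) b i, p (X * Matrix.single b i 1) =
      ∑ c, X c b • p (Matrix.single c i 1) := by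
    intro X b i
    have : X * Matrix.single b i 1 = ∑ c, X c b • Matrix.single c i (1 : ℂ) := by
      ext u v
      simp [Matrix.mul_apply, Matrix.sum_apply, Matrix.single_apply]
      by_cases h : i = v <;> simp [h]
    rw [this, map_sum]
    exact Finset.sum_congr rfl fun c _ => map_smul _ _ _
  let B : I → I → Matrix I I ℂ := fun i j a b => p (Matrix.single b i 1) a j
  have hB : ∀ i j, T * B i j = B i j * T := by
    intro i j
    apply hT
    intro g
    ext a b
    have := congrFun (congrFun ((hpP g (Matrix.single b i 1)).symm.trans (hlin _ b i)) a) j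
    simp only [Matrix.mul_apply, Matrix.sum_apply, Matrix.smul_apply, smul_eq_mul] at this ⊢
    simp only [B, this]
    exact Finset.sum_congr rfl fun _ _ => mul_comm _ _
  have key : ∀ b i, p (T * Matrix.single b i 1) = T * p (Matrix.single b i 1) := by
    intro b i
    rw [hlin]
    ext a j
    have := congrFun (congrFun (hB i j) a) b
    simp only [Matrix.mul_apply, Matrix.sum_apply, Matrix.smul_apply, smul_eq_mul] at this ⊢
    simp only [B] at this
    rw [this]
    exact Finset.sum_congr rfl fun _ _ => mul_comm _ _
  have h1 : (1 : Matrix I I ℂ) = ∑ b, Matrix.single b b 1 := by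
    ext u v
    rw [Matrix.sum_apply, Finset.sum_eq_single u]
    · simp [Matrix.single_apply, Matrix.one_apply]
    · intro b _ hb
      simp [hb]
    · simp
  have : p T = T := by
    calc p T = p (T * 1) := by rw [mul_one]
      _ = ∑ b, p (T * Matrix.single b b 1) := by rw [h1, Finset.mul_sum, map_sum]
      _ = T * p 1 := by simp only [key]; rw [h1, map_sum, Finset.mul_sum]
      _ = T := by rw [hp1, mul_one]
  rw [← this]
  exact hpA T

lemma aux_polar {k : ℕ} {V : Type*} [AddCommGroup V] [Module ℂ V]
    (M : MultilinearMap ℂ (fun _ : Fin k => V) ℂ) (hM : ∀ y, M (fun _ => y) = 0)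
    (Y : Fin k → V) : ∑ σ : Equiv.Perm (Fin k), M (fun i => Y (σ i)) = 0 := by
  classical
  let s : Fin 2 → ℂ := ![-1, 1]
  let e : Fin 2 → ℂ := ![0, 1]
  have h0 : ∑ ε : Fin k → Fin 2, (∏ i, s (ε i)) * M (fun _ => ∑ i, e (ε i) • Y i) = 0 := by
    simp [hM]
  have h1 : ∀ ε : Fin k → Fin 2, M (fun _ => ∑ i, e (ε i) • Y i) =
      ∑ φ : Fin k → Fin k, (∏ j, e (ε (φ j))) * M (fun j => Y (φ j)) := by
    intro ε
    rw [M.map_sum]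
    refine Finset.sum_congr rfl fun φ _ => ?_
    rw [M.map_smul_univ (fun j => e (ε (φ j))) (fun j => Y (φ j))]
    simp
  simp only [h1, Finset.mul_sum] at h0
  rw [Finset.sum_comm] at h0
  have h2 : ∀ φ : Fin k → Fin k, ∑ ε : Fin k → Fin 2,
      (∏ i, s (ε i)) * ((∏ j, e (ε (φ j))) * M (fun j => Y (φ j))) =
      if Function.Bijective φ then M (fun j => Y (φ j)) else 0 := by
    intro φ
    simp only [← mul_assoc, ← Finset.sum_mul]
    have h3 : ∑ ε : Fin k → Fin 2, (∏ i, s (ε i)) * (∏ j, e (ε (φ j))) =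
        ∏ i, (1 - if i ∈ Set.range φ then 0 else 1 : ℂ) := by
      have : ∀ i, (1 - if i ∈ Set.range φ then 0 else 1 : ℂ) =
          ∑ u : Fin 2, s u * (if i ∈ Set.range φ then e u else 1) := by
        intro i
        by_cases h : i ∈ Set.range φ <;> simp [h, s, e]
      simp only [this]
      rw [Finset.prod_univ_sum]
      simp only [Fintype.piFinset_univ, Finset.prod_mul_distrib]
      refine Finset.sum_congr rfl fun ε _ => ?_
      congr 1
      by_cases h : ∃ j, ε (φ j) = 0
      · obtain ⟨j, hj⟩ := h
        rw [Finset.prod_eq_zero (Finset.mem_univ j) (by simp [hj, e]),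
          Finset.prod_eq_zero (Finset.mem_univ (φ j)) (by simp [hj, e])]
      · push Not at h
        have h' : ∀ j, ε (φ j) = 1 := fun j => by have := h j; omega
        rw [Finset.prod_eq_one, Finset.prod_eq_one]
        · intro i _
          split_ifs with hi
          · obtain ⟨j, rfl⟩ := hi
            simp [h', e]
          · rfl
        · intro i _; simp [h', e]
    rw [h3]
    split_ifs with hb
    · have : ∀ i, i ∈ Set.range φ := hb.2
      simp [this]
    · have : ∃ i, i ∉ Set.range φ := by
        by_contra! hc
        exact hb (Finite.surjective_iff_bijective.1 hc)
      obtain ⟨i, hi⟩ := this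
      rw [Finset.prod_eq_zero (Finset.mem_univ i) (by simp only [hi]; simp), zero_mul]
  simp only [h2] at h0
  rw [← h0, ← Finset.sum_filter]
  refine Finset.sum_bij' (fun σ _ => ⇑σ)
    (fun φ h => Equiv.ofBijective φ (by simpa using h)) ?_ ?_ ?_ ?_ ?_
  · intro σ _; exact Finset.mem_filter.2 ⟨Finset.mem_univ _, σ.bijective⟩
  · simp
  · intro σ _; ext; simp
  · intro φ _; ext; simp
  · simp

lemma aux_expand {n k : ℕ}
    (M : MultilinearMap ℂ (fun _ : Fin k => Matrix (Fin n) (Fin n) ℂ) ℂ)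
    (X : Fin k → Matrix (Fin n) (Fin n) ℂ) :
    M X = ∑ a : Fin k → Fin n, ∑ b : Fin k → Fin n, (∏ i, X i (a i) (b i)) *
      M (fun i => Matrix.single (a i) (b i) 1) := by
  have : X = fun i => ∑ a, ∑ b, X i a b • Matrix.single a b (1 : ℂ) := by
    funext i
    conv_lhs => rw [Matrix.matrix_eq_sum_single (X i)]
    simp
  conv_lhs => rw [this]
  rw [M.map_sum]
  refine Finset.sum_congr rfl fun a _ => ?_
  rw [M.map_sum]
  refine Finset.sum_congr rfl fun b _ => ?_
  rw [M.map_smul_univ (fun i => X i (a i) (b i)), smul_eq_mul]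

lemma aux_dense {n k : ℕ}
    (M : MultilinearMap ℂ (fun _ : Fin k => Matrix (Fin n) (Fin n) ℂ) ℂ)
    (hM : ∀ g, IsUnit g → M (fun _ => g) = 0) (Y : Matrix (Fin n) (Fin n) ℂ) :
    M (fun _ => Y) = 0 := by
  have hc : Continuous fun t : ℂ => M (fun _ => Matrix.scalar (Fin n) t + Y) := by
    refine (continuous_congr fun t => aux_expand M _).mpr ?_
    simp only [Matrix.add_apply, Matrix.scalar_apply, Matrix.diagonal_apply]
    refine continuous_finsetSum _ fun a _ => continuous_finsetSum _ fun b _ =>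
      (continuous_finsetProd _ fun i _ => ?_).mul continuous_const
    split_ifs <;> fun_prop
  have hfin : Set.Finite {t : ℂ | (-Y).charpoly.IsRoot t} :=
    Polynomial.finite_setOfPred_isRoot (Matrix.charpoly_monic _).ne_zero
  have hd : Dense {t : ℂ | (-Y).charpoly.IsRoot t}ᶜ := hfin.countable.dense_compl ℂ
  have := Continuous.ext_on hd hc (continuous_const (y := (0 : ℂ))) (by
    intro t ht
    apply hM
    rw [Matrix.isUnit_iff_isUnit_det, isUnit_iff_ne_zero]
    intro h0
    apply ht
    simpa [Polynomial.IsRoot, Matrix.eval_charpoly] using h0)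
  simpa using congrFun this 0

/-- The permutation matrices on multi-indices. -/
noncomputable def auxP (n k : ℕ) :
    Equiv.Perm (Fin k) →* Matrix (Fin k → Fin n) (Fin k → Fin n) ℂ where
  toFun σ := Matrix.of fun a b => if a ∘ σ = b then 1 else 0
  map_one' := by
    ext a b
    simp [Matrix.one_apply]
  map_mul' σ τ := by
    ext a b
    simp only [Matrix.mul_apply, Matrix.of_apply, ite_mul, one_mul, zero_mul, Finset.sum_ite_eq,
      Finset.mem_univ, if_true, Equiv.Perm.coe_mul, Function.comp_assoc]
    congr

lemma auxP_apply {n k : ℕ} (σ : Equiv.Perm (Fin k)) (a b : Fin k → Fin n) :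
    auxP n k σ a b = if a ∘ σ = b then 1 else 0 := rfl

lemma aux_fft {n k : ℕ}
    (F : MultilinearMap ℂ (fun _ : Fin k => Matrix (Fin n) (Fin n) ℂ) ℂ)
    (hF : ∀ g, IsUnit g → ∀ X : Fin k → Matrix (Fin n) (Fin n) ℂ,
      F (fun i => g * X i * g⁻¹) = F X) :
    ∃ c : Equiv.Perm (Fin k) → ℂ, ∀ X, F X = ∑ σ, c σ *
      ∑ j : Fin k → Fin n, ∏ i : Fin k, X i (j i) (j (σ i)) := by
  classical
  -- commutation
  have hcomm : ∀ X Y : Fin k → Matrix (Fin n) (Fin n) ℂ,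
      ∑ σ : Equiv.Perm (Fin k), F (fun i => Y (σ i) * X i) =
      ∑ σ : Equiv.Perm (Fin k), F (fun i => X i * Y (σ i)) := by
    intro X Y
    let M : MultilinearMap ℂ (fun _ : Fin k => Matrix (Fin n) (Fin n) ℂ) ℂ :=
      F.compLinearMap (fun i => LinearMap.mulRight ℂ (X i)) -
      F.compLinearMap (fun i => LinearMap.mulLeft ℂ (X i))
    have hM : ∀ Z, M Z = F (fun i => Z i * X i) - F (fun i => X i * Z i) := by
      intro Z
      simp [M, MultilinearMap.compLinearMap_apply]
    have h := aux_polar M (aux_dense M (by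
      intro g hg
      rw [hM, sub_eq_zero, ← hF g hg (fun i => X i * g)]
      congr 1
      funext i
      have hg' := (Matrix.isUnit_iff_isUnit_det g).1 hg
      simp only [mul_assoc, Matrix.mul_nonsing_inv g hg', mul_one])) Y
    simp only [hM, Finset.sum_sub_distrib] at h
    exact sub_eq_zero.1 h
  let T : Matrix (Fin k → Fin n) (Fin k → Fin n) ℂ :=
    Matrix.of fun a b => F (fun i => Matrix.single (b i) (a i) 1)
  have hTa : ∀ a b, T a b = F (fun i => Matrix.single (b i) (a i) 1) := fun _ _ => rfl
  have hsingle : ∀ a b c d : Fin k → Fin n,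
      F (fun i => Matrix.single (a i) (b i) 1 * Matrix.single (c i) (d i) 1) =
        if b = c then T d a else 0 := by
    intro a b c d
    split_ifs with h
    · subst h
      simp [hTa]
    · obtain ⟨i, hi⟩ := Function.ne_iff.1 h
      apply F.map_coord_zero i
      simp [hi]
  have hE : ∀ c d : Fin k → Fin n,
      T * (∑ σ : Equiv.Perm (Fin k), Matrix.single (c ∘ σ) (d ∘ σ) 1) =
      (∑ σ : Equiv.Perm (Fin k), Matrix.single (c ∘ σ) (d ∘ σ) 1) * T := by
    intro c d
    rw [Finset.mul_sum, Finset.sum_mul]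
    ext b a
    have h := hcomm (fun i => Matrix.single (a i) (b i) 1) (fun i => Matrix.single (c i) (d i) 1)
    have h1 : ∀ σ : Equiv.Perm (Fin k), F (fun i => Matrix.single (c (σ i)) (d (σ i)) 1 *
        Matrix.single (a i) (b i) 1) = (T * Matrix.single (c ∘ σ) (d ∘ σ) (1 : ℂ) :
          Matrix (Fin k → Fin n) (Fin k → Fin n) ℂ) b a := by
      intro σ
      refine (hsingle (c ∘ σ) (d ∘ σ) a b).trans ?_
      split_ifs with h
      · subst h; simp
      · simp [Matrix.mul_apply, Matrix.single_apply, h]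
    have h2 : ∀ σ : Equiv.Perm (Fin k), F (fun i => Matrix.single (a i) (b i) 1 *
        Matrix.single (c (σ i)) (d (σ i)) 1) = (Matrix.single (c ∘ σ) (d ∘ σ) (1 : ℂ) * T :
          Matrix (Fin k → Fin n) (Fin k → Fin n) ℂ) b a := by
      intro σ
      refine (hsingle a b (c ∘ σ) (d ∘ σ)).trans ?_
      split_ifs with h
      · subst h; simp
      · simp [Matrix.mul_apply, Matrix.single_apply, Ne.symm h]
    simp only [h1, h2] at h
    simpa only [Matrix.sum_apply] using h
  have hspan := aux_dc (auxP n k) T (by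
    intro B hB
    have hB' : ∀ (σ : Equiv.Perm (Fin k)) c d, B (c ∘ σ) (d ∘ σ) = B c d := by
      intro σ c d
      have h := congrFun (congrFun (hB σ) c) (d ∘ σ)
      have h3 : ∀ x : Fin k → Fin n, x ∘ σ = d ∘ σ ↔ x = d := fun x =>
        (Equiv.surjective σ).injective_comp_right.eq_iff
      simpa [Matrix.mul_apply, auxP_apply, h3] using h
    have hBs : (Fintype.card (Equiv.Perm (Fin k)) : ℂ) • B = ∑ c, ∑ d, B c d •
        ∑ σ : Equiv.Perm (Fin k), Matrix.single (c ∘ σ) (d ∘ σ) (1 : ℂ) := by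
      have h4 : ∀ σ : Equiv.Perm (Fin k),
          B = ∑ c, ∑ d, B c d • Matrix.single (c ∘ σ) (d ∘ σ) (1 : ℂ) := by
        intro σ
        conv_lhs => rw [Matrix.matrix_eq_sum_single B]
        let e : (Fin k → Fin n) ≃ (Fin k → Fin n) := σ.symm.arrowCongr (Equiv.refl _)
        have he : ∀ c, e c = c ∘ σ := fun c => rfl
        rw [← e.sum_comp]
        refine Finset.sum_congr rfl fun c _ => ?_
        rw [← e.sum_comp]
        refine Finset.sum_congr rfl fun d _ => ?_
        rw [he, he, hB']
        simp
      simp only [Finset.smul_sum]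
      rw [Finset.sum_congr rfl fun c _ => Finset.sum_comm, Finset.sum_comm]
      rw [Finset.sum_congr rfl fun σ _ => (h4 σ).symm]
      simp [← Nat.cast_smul_eq_nsmul ℂ]
    have hne : (Fintype.card (Equiv.Perm (Fin k)) : ℂ) ≠ 0 :=
      Nat.cast_ne_zero.2 Fintype.card_ne_zero
    have h5 : (Fintype.card (Equiv.Perm (Fin k)) : ℂ) • (T * B) =
        (Fintype.card (Equiv.Perm (Fin k)) : ℂ) • (B * T) := by
      rw [← mul_smul_comm, ← smul_mul_assoc, hBs, Finset.mul_sum, Finset.sum_mul]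
      refine Finset.sum_congr rfl fun c _ => ?_
      rw [Finset.mul_sum, Finset.sum_mul]
      refine Finset.sum_congr rfl fun d _ => ?_
      rw [mul_smul_comm, smul_mul_assoc, hE]
    exact smul_right_injective _ hne h5)
  obtain ⟨c, hc⟩ := (Submodule.mem_span_range_iff_exists_fun ℂ).1 hspan
  refine ⟨fun σ => c σ⁻¹, fun X => ?_⟩
  rw [aux_expand F X]
  have hTab : ∀ a b, F (fun i => Matrix.single (a i) (b i) 1) =
      ∑ σ, c σ * (if b ∘ σ = a then 1 else 0) := by
    intro a b
    rw [← hTa, ← hc]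
    simp [Matrix.sum_apply, auxP_apply]
  simp only [hTab, Finset.mul_sum]
  rw [← Equiv.sum_comp (Equiv.inv (Equiv.Perm (Fin k)))
    (fun σ => ∑ j : Fin k → Fin n, c σ⁻¹ * ∏ i : Fin k, X i (j i) (j (σ i)))]
  rw [Finset.sum_congr rfl fun a _ => Finset.sum_comm, Finset.sum_comm]
  refine Finset.sum_congr rfl fun σ _ => Finset.sum_congr rfl fun a _ => ?_
  have h6 : ∀ b : Fin k → Fin n, b ∘ σ = a ↔ b = a ∘ ⇑σ⁻¹ := by
    intro b
    constructor
    · rintro rfl; funext i; simp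
    · rintro rfl; funext i; simp
  simp [h6, mul_comm]

lemma aux_inv (n k : ℕ) (hn : 1 ≤ n)
    (F : MultilinearMap ℂ (fun _ : Fin k => Matrix (Fin n) (Fin n) ℂ) ℂ)
    (hF : ∀ g : Matrix (Fin n) (Fin n) ℂ, IsUnit g → g.det = 1 →
      ∀ X : Fin k → Matrix (Fin n) (Fin n) ℂ, F (fun i => g * X i * g⁻¹) = F X)
    (g : Matrix (Fin n) (Fin n) ℂ) (hg : IsUnit g) (X : Fin k → Matrix (Fin n) (Fin n) ℂ) :
    F (fun i => g * X i * g⁻¹) = F X := by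
  have hd : IsUnit g.det := (Matrix.isUnit_iff_isUnit_det g).1 hg
  obtain ⟨z, hz⟩ := IsAlgClosed.exists_pow_nat_eq (g.det)⁻¹ hn
  have hz0 : z ≠ 0 := by
    rintro rfl
    rw [zero_pow (by omega)] at hz
    exact hd.ne_zero (inv_eq_zero.1 hz.symm)
  have hdet : (z • g).det = 1 := by
    rw [Matrix.det_smul, Fintype.card_fin, hz, inv_mul_cancel₀ hd.ne_zero]
  have hu : IsUnit (z • g) := (Matrix.isUnit_iff_isUnit_det _).2 (by rw [hdet]; exact isUnit_one)
  have hinv : (z • g)⁻¹ = z⁻¹ • g⁻¹ := by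
    apply Matrix.inv_eq_right_inv
    rw [smul_mul_smul_comm, mul_inv_cancel₀ hz0, Matrix.mul_nonsing_inv g hd, one_smul]
  rw [← hF _ hu hdet X]
  congr 1
  funext i
  rw [hinv, smul_mul_assoc, smul_mul_smul_comm, mul_inv_cancel₀ hz0, one_smul]

theorem invariant_multilinear_sl_mem_span_trace_monomials
    (n k : ℕ) (hn : 1 ≤ n)
    (f : MultilinearMap ℂ
      (fun _ : Fin k => ↥(LieAlgebra.SpecialLinear.sl (Fin n) ℂ)) ℂ)
    (hf : ∀ g : Matrix (Fin n) (Fin n) ℂ, IsUnit g → g.det = 1 →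
      ∀ X Y : Fin k → ↥(LieAlgebra.SpecialLinear.sl (Fin n) ℂ),
        (∀ i, (Y i : Matrix (Fin n) (Fin n) ℂ)
            = g * (X i : Matrix (Fin n) (Fin n) ℂ) * g⁻¹) →
        f Y = f X) :
    ⇑f ∈ Submodule.span ℂ
      {h : (Fin k → ↥(LieAlgebra.SpecialLinear.sl (Fin n) ℂ)) → ℂ |
        ∃ σ : Equiv.Perm (Fin k),
          h = fun X => ∑ j : Fin k → Fin n, ∏ i : Fin k,
            (X i : Matrix (Fin n) (Fin n) ℂ) (j i) (j (σ i))} := by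
  classical
  have hn0 : (n : ℂ) ≠ 0 := Nat.cast_ne_zero.2 (by omega)
  have mem_sl : ∀ A : Matrix (Fin n) (Fin n) ℂ,
      A ∈ LieAlgebra.SpecialLinear.sl (Fin n) ℂ ↔ A.trace = 0 := fun A => Iff.rfl
  let π : Matrix (Fin n) (Fin n) ℂ →ₗ[ℂ] ↥(LieAlgebra.SpecialLinear.sl (Fin n) ℂ) :=
    { toFun := fun A => ⟨A - ((n : ℂ)⁻¹ * A.trace) • 1, by
        rw [mem_sl, Matrix.trace_sub, Matrix.trace_smul, Matrix.trace_one, Fintype.card_fin,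
          smul_eq_mul]
        field_simp
        ring⟩
      map_add' := fun A B => by
        apply Subtype.ext
        change A + B - ((n : ℂ)⁻¹ * (A + B).trace) • (1 : Matrix (Fin n) (Fin n) ℂ) =
          (A - ((n : ℂ)⁻¹ * A.trace) • 1) + (B - ((n : ℂ)⁻¹ * B.trace) • 1)
        rw [Matrix.trace_add]
        module
      map_smul' := fun c A => by
        apply Subtype.ext
        change c • A - ((n : ℂ)⁻¹ * (c • A).trace) • (1 : Matrix (Fin n) (Fin n) ℂ) =
          c • (A - ((n : ℂ)⁻¹ * A.trace) • 1)
        rw [Matrix.trace_smul, smul_eq_mul]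
        module }
  have hπ : ∀ A, (π A : Matrix (Fin n) (Fin n) ℂ) = A - ((n : ℂ)⁻¹ * A.trace) • 1 := fun _ => rfl
  have hπ' : ∀ A : ↥(LieAlgebra.SpecialLinear.sl (Fin n) ℂ), π A = A := by
    intro A
    apply Subtype.ext
    have : (A : Matrix (Fin n) (Fin n) ℂ).trace = 0 := A.2
    rw [hπ, this]
    simp
  have hinv := aux_inv n k hn (f.compLinearMap fun _ => π) (by
    intro g hg hdet X
    rw [MultilinearMap.compLinearMap_apply, MultilinearMap.compLinearMap_apply]
    apply hf g hg hdet
    intro i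
    have hg' := (Matrix.isUnit_iff_isUnit_det g).1 hg
    rw [hπ, hπ, Matrix.trace_mul_cycle, Matrix.nonsing_inv_mul g hg', one_mul, mul_sub, sub_mul,
      mul_smul_comm, smul_mul_assoc, mul_one, Matrix.mul_nonsing_inv g hg'])
  obtain ⟨c, hc⟩ := aux_fft _ hinv
  have hfe : ⇑f = ∑ σ : Equiv.Perm (Fin k), c σ •
      fun X : Fin k → ↥(LieAlgebra.SpecialLinear.sl (Fin n) ℂ) =>
        ∑ j : Fin k → Fin n, ∏ i : Fin k,
            (X i : Matrix (Fin n) (Fin n) ℂ) (j i) (j (σ i)) := by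
    funext X
    have h := hc (fun i => X i)
    rw [MultilinearMap.compLinearMap_apply] at h
    simp only [hπ'] at h
    rw [h]
    simp [Finset.sum_apply]
  rw [hfe]
  exact Submodule.sum_mem _ fun σ _ => Submodule.smul_mem _ _ (Submodule.subset_span ⟨σ, rfl⟩)
end

section
/- Let n = 2r+1 with r ≥ 1 and let k ≥ 0. Let f be a k-multilinear map on so(n,ℂ) = {X : Matrix (Fin n) (Fin n) ℂ | Xᵀ = −X} with values in ℂ such that f(S X₁ S⁻¹, …, S X_k S⁻¹) = f(X₁, …, X_k) for every S in SO(n,ℂ) (complex n×n matrices with Sᵀ S = 1 and det S = 1) and all skew-symmetric X₁,…,X_k. Then f lies in the ℂ-linear span of the restrictions to so(n,ℂ) of the trace monomials T_σ, as σ ranges over all permutations of {1,…,k}. -/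
/-!
STATEMENT 1 (B_r case of the main theorem): every `SO(2r+1,ℂ)`-invariant `k`-multilinear
map on `so(2r+1,ℂ)` lies in the ℂ-span of (restrictions of) trace monomials `T_σ`.

For a permutation `σ` of `Fin k`, the trace monomial is realized by the standard
entry formula `T_σ (X₁,…,X_k) = ∑_{j : Fin k → Fin n} ∏ i, (X i) (j i) (j (σ i))`,
which equals the product over the cycles `(i₁ … i_m)` of `σ` of `tr (X_{i₁} ⋯ X_{i_m})`.
-/

/-- The Lie algebra `so(n,ℂ)` of skew-symmetric complex `n × n` matrices,
as a submodule of the matrix space. -/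
noncomputable def soSubmodule (n : ℕ) : Submodule ℂ (Matrix (Fin n) (Fin n) ℂ) where
  carrier := {X | X.transpose = -X}
  add_mem' := by
    intro a b ha hb
    simp only [Set.mem_setOf_eq] at *
    rw [Matrix.transpose_add, ha, hb, neg_add]
  zero_mem' := by simp
  smul_mem' := by
    intro c a ha
    simp only [Set.mem_setOf_eq] at *
    rw [Matrix.transpose_smul, ha, smul_neg]

set_option linter.unusedSectionVars false
set_option linter.unusedSimpArgs false

namespace SOInv
open Finset Function

section tensors
variable {ι : Type} [Fintype ι] [DecidableEq ι] {n : ℕ}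

/-- the operator moving index `i` to `j` -/
noncomputable def E (i j : Fin n) (f : (ι → Fin n) → ℂ) (w : ι → Fin n) : ℂ :=
  ∑ x, if w x = i then f (update w x j) else 0

def IsInv (f : (ι → Fin n) → ℂ) : Prop := ∀ i j w, E i j f w = E j i f w

noncomputable def delta (p : ι → ι) (w : ι → Fin n) : ℂ :=
  if ∀ x, w (p x) = w x then 1 else 0

def IsMatching {ι : Type} (p : ι → ι) : Prop := (∀ x, p (p x) = x) ∧ (∀ x, p x ≠ x)

noncomputable def matchSpan (ι : Type) [Fintype ι] [DecidableEq ι] (n : ℕ) :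
    Submodule ℂ ((ι → Fin n) → ℂ) :=
  Submodule.span ℂ {g | ∃ p : ι → ι, IsMatching p ∧ g = delta p}

lemma E_sub (i j : Fin n) (f g : (ι → Fin n) → ℂ) (w) :
    E i j (f - g) w = E i j f w - E i j g w := by
  simp only [E, ← Finset.sum_sub_distrib]
  refine Finset.sum_congr rfl fun x _ => ?_
  split_ifs <;> simp

lemma E_add (i j : Fin n) (f g : (ι → Fin n) → ℂ) (w) :
    E i j (f + g) w = E i j f w + E i j g w := by
  simp only [E, ← Finset.sum_add_distrib]
  refine Finset.sum_congr rfl fun x _ => ?_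
  split_ifs <;> simp

lemma E_smul (i j : Fin n) (c : ℂ) (g : (ι → Fin n) → ℂ) (w) :
    E i j (c • g) w = c * E i j g w := by
  simp only [E, Finset.mul_sum]
  refine Finset.sum_congr rfl fun x _ => ?_
  split_ifs <;> simp

lemma E_adj (i j : Fin n) (f g : (ι → Fin n) → ℂ) :
    ∑ w, star (f w) * E i j g w = ∑ w, star (E j i f w) * g w := by
  simp only [E, Finset.mul_sum, star_sum, Finset.sum_mul]
  rw [Finset.sum_comm]
  conv_rhs => rw [Finset.sum_comm]
  refine Finset.sum_congr rfl fun x _ => ?_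
  have h1 : ∀ w : ι → Fin n, star (f w) * (if w x = i then g (update w x j) else 0)
      = if w x = i then star (f w) * g (update w x j) else 0 := by
    intro w; split_ifs <;> simp
  have h2 : ∀ w : ι → Fin n, star (if w x = j then f (update w x i) else 0) * g w
      = if w x = j then star (f (update w x i)) * g w else 0 := by
    intro w; split_ifs <;> simp
  simp only [h1, h2, ← Finset.sum_filter]
  refine Finset.sum_nbij' (fun w => update w x j) (fun w => update w x i) ?_ ?_ ?_ ?_ ?_
  · intro w hw; simp
  · intro w hw; simp
  · intro w hw; simp at hw; simp [← hw]
  · intro w hw; simp at hw; simp [← hw]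
  · intro w hw; simp at hw; simp [← hw]

lemma delta_key {p : ι → ι} (hp : IsMatching p) (i j : Fin n) (w : ι → Fin n) (x : ι)
    (h : w x = i) (h2 : ∀ y, update w x j (p y) = update w x j y) :
    w (p x) = j ∧ ∀ y, update w (p x) i (p y) = update w (p x) i y := by
  have hx := hp.2 x
  have hxx := hp.1 x
  have h3 : w (p x) = j := by
    have := h2 x
    simpa [update_apply, hx] using this
  refine ⟨h3, fun y => ?_⟩
  have := h2 y
  have h4 := hp.1 y
  have h5 := hp.2 y
  simp only [update_apply] at this ⊢
  by_cases hy : y = x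
  · subst hy; simp [hx, h, h3, Ne.symm hx]
  · by_cases hy2 : y = p x
    · subst hy2; simp [hxx, h, h3, Ne.symm hx]
    · have : p y ≠ x := by rintro rfl; exact hy2 h4.symm
      have : p y ≠ p x := by intro h6; apply hy; rw [← h4, h6, hxx]
      simp_all

lemma delta_inv {p : ι → ι} (hp : IsMatching p) : IsInv (delta p : (ι → Fin n) → ℂ) := by
  intro i j w
  simp only [E, delta, ← ite_and]
  let q : Equiv.Perm ι := ⟨p, p, hp.1, hp.1⟩
  rw [← Equiv.sum_comp q]
  refine Finset.sum_congr rfl fun x _ => ?_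
  refine if_congr ⟨fun h => ?_, fun h => ?_⟩ rfl rfl
  · have := delta_key hp i j w (p x) h.1 h.2
    rwa [hp.1] at this
  · exact delta_key hp j i w x h.1 h.2

lemma matchSpan_inv {f : (ι → Fin n) → ℂ} (hf : f ∈ matchSpan ι n) : IsInv f := by
  unfold matchSpan at hf
  induction hf using Submodule.span_induction with
  | mem g hg => obtain ⟨p, hp, rfl⟩ := hg; exact delta_inv hp
  | zero => intro i j w; simp [E]
  | add f g _ _ hf hg => intro i j w; rw [E_add, E_add, hf, hg]
  | smul c f _ hf => intro i j w; rw [E_smul, E_smul, hf]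

end tensors

lemma exists_decomp {T : Type} [Fintype T] (M : Submodule ℂ (T → ℂ)) (f : T → ℂ) :
    ∃ g ∈ M, ∀ u ∈ M, ∑ w, star (u w) * (f - g) w = 0 := by
  classical
  let e := WithLp.linearEquiv 2 ℂ (T → ℂ)
  let K : Submodule ℂ (EuclideanSpace ℂ T) := M.comap e.toLinearMap
  obtain ⟨y, hy, z, hz, hyz⟩ := K.exists_add_mem_mem_orthogonal (WithLp.toLp 2 f)
  refine ⟨e y, hy, fun u hu => ?_⟩
  have := hz (WithLp.toLp 2 u) hu
  rw [PiLp.inner_apply] at this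
  rw [← this]
  refine Finset.sum_congr rfl fun w _ => ?_
  have h : f w = y w + z w := by
    have := congrArg (fun v : EuclideanSpace ℂ T => v w) hyz
    simpa using this
  simp [e, h, mul_comm]

lemma eq_zero_of_sum {T : Type} [Fintype T] (g : T → ℂ) (h : ∑ w, star (g w) * g w = 0) :
    g = 0 := by
  have h1 : ∑ w, Complex.normSq (g w) = 0 := by
    have : ((∑ w, Complex.normSq (g w) : ℝ) : ℂ) = 0 := by
      rw [← h]; push_cast
      refine Finset.sum_congr rfl fun w _ => ?_
      rw [Complex.normSq_eq_conj_mul_self]; rfl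
    exact_mod_cast this
  rw [Finset.sum_eq_zero_iff_of_nonneg (fun w _ => Complex.normSq_nonneg _)] at h1
  funext w
  simpa using h1 w (Finset.mem_univ w)

section contraction
variable {ι : Type} [Fintype ι] [DecidableEq ι] {n : ℕ}

abbrev Rest (a b : ι) := {x : ι // x ≠ a ∧ x ≠ b}

def ext (a b : ι) (w : Rest a b → Fin n) (i j : Fin n) (x : ι) : Fin n :=
  if h : x ≠ a ∧ x ≠ b then w ⟨x, h⟩ else if x = a then i else j

lemma ext_a (a b : ι) (w : Rest a b → Fin n) (i j : Fin n) : ext a b w i j a = i := by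
  simp [ext]

lemma ext_b {a b : ι} (hab : a ≠ b) (w : Rest a b → Fin n) (i j : Fin n) :
    ext a b w i j b = j := by
  simp [ext, hab.symm]

lemma ext_r {a b : ι} (w : Rest a b → Fin n) (i j : Fin n) (x : Rest a b) :
    ext a b w i j x = w x := by
  rw [ext, dif_pos x.2]

lemma cases_ab (a b x : ι) : x = a ∨ x = b ∨ ∃ y : Rest a b, x = y := by
  by_cases h : x = a
  · exact Or.inl h
  · by_cases h' : x = b
    · exact Or.inr (Or.inl h')
    · exact Or.inr (Or.inr ⟨⟨x, h, h'⟩, rfl⟩)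

lemma fun_ext_ab {a b : ι} {v w : ι → Fin n} (h1 : v a = w a) (h2 : v b = w b)
    (h3 : ∀ y : Rest a b, v y = w y) : v = w := by
  funext x
  rcases cases_ab a b x with rfl | rfl | ⟨y, rfl⟩
  · exact h1
  · exact h2
  · exact h3 y

lemma sum_split {R : Type} [AddCommMonoid R] {a b : ι} (hab : a ≠ b) (φ : ι → R) :
    ∑ x, φ x = φ a + (φ b + ∑ x : Rest a b, φ x) := by
  rw [← Finset.add_sum_erase univ φ (Finset.mem_univ a),
    ← Finset.add_sum_erase (univ.erase a) φ (a := b) (by simp [hab.symm])]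
  congr 2
  refine Finset.sum_subtype _ ?_ φ
  intro x; simp; tauto

lemma card_rest {a b : ι} (hab : a ≠ b) : Fintype.card ι = Fintype.card (Rest a b) + 2 := by
  have := sum_split hab (fun _ => (1 : ℕ))
  simp only [Finset.sum_const, Finset.card_univ, smul_eq_mul, mul_one] at this
  omega

noncomputable def contr (a b : ι) (f : (ι → Fin n) → ℂ) (w : Rest a b → Fin n) : ℂ :=
  ∑ l, f (ext a b w l l)

lemma update_ext_a {a b : ι} (hab : a ≠ b) (w : Rest a b → Fin n) (i j l : Fin n) :
    update (ext a b w i j) a l = ext a b w l j := by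
  apply fun_ext_ab (a := a) (b := b)
  · simp [ext_a]
  · simp [ext_b hab, hab.symm]
  · intro y; rw [update_of_ne y.2.1, ext_r, ext_r]

lemma update_ext_b {a b : ι} (hab : a ≠ b) (w : Rest a b → Fin n) (i j l : Fin n) :
    update (ext a b w i j) b l = ext a b w i l := by
  apply fun_ext_ab (a := a) (b := b)
  · simp [ext_a, hab]
  · simp [ext_b hab]
  · intro y; rw [update_of_ne y.2.2, ext_r, ext_r]

lemma update_ext_r {a b : ι} (hab : a ≠ b) (w : Rest a b → Fin n) (i j l : Fin n)
    (x : Rest a b) :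
    update (ext a b w i j) x l = ext a b (update w x l) i j := by
  apply fun_ext_ab (a := a) (b := b)
  · rw [update_of_ne x.2.1.symm, ext_a, ext_a]
  · rw [update_of_ne x.2.2.symm, ext_b hab, ext_b hab]
  · intro y
    rw [ext_r]
    by_cases h : y = x
    · subst h; simp
    · rw [update_of_ne h, update_of_ne (fun h' => h (Subtype.ext h')), ext_r]

lemma E_contr {a b : ι} (hab : a ≠ b) (f : (ι → Fin n) → ℂ) (i j : Fin n)
    (w : Rest a b → Fin n) :
    E i j (contr a b f) w =
      ∑ l, E i j f (ext a b w l l) - f (ext a b w j i) - f (ext a b w i j) := by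
  have h : ∀ l, E i j f (ext a b w l l) = (if l = i then f (ext a b w j l) else 0) +
      ((if l = i then f (ext a b w l j) else 0) +
        ∑ x : Rest a b, if w x = i then f (ext a b (update w x j) l l) else 0) := by
    intro l
    unfold E
    rw [sum_split hab, ext_a, ext_b hab, update_ext_a hab, update_ext_b hab]
    simp only [ext_r, update_ext_r hab]
  simp only [h, Finset.sum_add_distrib, Finset.sum_ite_eq', Finset.mem_univ, if_true]
  rw [Finset.sum_comm]
  have : ∀ x : Rest a b, (∑ l, if w x = i then f (ext a b (update w x j) l l) else 0)
    = if w x = i then contr a b f (update w x j) else 0 := by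
    intro x; split_ifs <;> simp [contr]
  simp only [this]
  unfold E
  ring

lemma contr_inv {a b : ι} (hab : a ≠ b) {f : (ι → Fin n) → ℂ} (hf : IsInv f) :
    IsInv (contr a b f) := by
  intro i j w
  rw [E_contr hab, E_contr hab]
  simp only [hf i j]
  ring

def extp (a b : ι) (p : Rest a b → Rest a b) (x : ι) : ι :=
  if h : x ≠ a ∧ x ≠ b then p ⟨x, h⟩ else if x = a then b else a

lemma extp_a (a b : ι) (p : Rest a b → Rest a b) : extp a b p a = b := by simp [extp]
lemma extp_b {a b : ι} (hab : a ≠ b) (p : Rest a b → Rest a b) : extp a b p b = a := by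
  simp [extp, hab.symm]
lemma extp_r {a b : ι} (p : Rest a b → Rest a b) (x : Rest a b) : extp a b p x = p x := by
  rw [extp, dif_pos x.2]

lemma extp_matching {a b : ι} (hab : a ≠ b) {p : Rest a b → Rest a b} (hp : IsMatching p) :
    IsMatching (extp a b p) := by
  constructor
  · intro x
    rcases cases_ab a b x with rfl | rfl | ⟨y, rfl⟩
    · rw [extp_a, extp_b hab]
    · rw [extp_b hab, extp_a]
    · rw [extp_r, extp_r, hp.1]
  · intro x
    rcases cases_ab a b x with rfl | rfl | ⟨y, rfl⟩
    · rw [extp_a]; exact hab.symm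
    · rw [extp_b hab]; exact hab
    · rw [extp_r]; exact fun h => hp.2 y (Subtype.ext h)

lemma delta_extp {a b : ι} (hab : a ≠ b) (p : Rest a b → Rest a b) (w : ι → Fin n) :
    (∀ x, w (extp a b p x) = w x) ↔ w a = w b ∧ ∀ y : Rest a b, w (p y) = w y := by
  constructor
  · intro h
    refine ⟨?_, fun y => ?_⟩
    · rw [← h a, extp_a]
    · rw [← h y, extp_r]
  · rintro ⟨h1, h2⟩ x
    rcases cases_ab a b x with rfl | rfl | ⟨y, rfl⟩
    · rw [extp_a, h1]
    · rw [extp_b hab, h1]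
    · rw [extp_r, h2]

lemma sum_contr {a b : ι} (hab : a ≠ b) (p : Rest a b → Rest a b) (f : (ι → Fin n) → ℂ) :
    ∑ w, delta p w * contr a b f w = ∑ w, delta (extp a b p) w * f w := by
  simp only [contr, Finset.mul_sum]
  rw [← Fintype.sum_prod_type' (f := fun w l => delta p w * f (ext a b w l l))]
  refine Finset.sum_of_injOn (fun q => ext a b q.1 q.2 q.2) ?_ ?_ ?_ ?_
  · rintro ⟨w, l⟩ _ ⟨v, m⟩ _ h
    simp only at h
    have h1 : l = m := by rw [← ext_a a b w l l, h, ext_a]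
    subst h1
    have h2 : w = v := by
      funext x; rw [← ext_r w l l, h, ext_r]
    rw [h2]
  · intro q _; simp
  · intro w _ hw
    unfold delta
    rw [if_neg, zero_mul]
    rw [delta_extp hab]
    rintro ⟨h1, h2⟩
    apply hw
    refine ⟨(fun y => w y, w a), by simp, ?_⟩
    apply fun_ext_ab (a := a) (b := b)
    · simp [ext_a]
    · simp [ext_b hab, h1]
    · intro y
      change ext a b _ _ _ _ = _
      rw [ext_r]
  · rintro ⟨w, l⟩ _
    simp only [delta, delta_extp hab, ext_a, ext_b hab, ext_r, true_and]

end contraction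

section main
variable {ι : Type} [Fintype ι] [DecidableEq ι] {n : ℕ}

lemma casimir {h : (ι → Fin n) → ℂ}
    (ht : ∀ (x y : ι) (w : ι → Fin n), x ≠ y → ∑ l, h (update (update w x l) y l) = 0)
    (w : ι → Fin n) :
    ∑ i, ∑ j, E j i (E j i h) w = (Fintype.card ι : ℂ) * h w := by
  have h1 : ∀ i, ∑ j, E j i (E j i h) w = ∑ x, ∑ y,
      if update w x i y = w x then h (update (update w x i) y i) else 0 := by
    intro i
    simp only [E]
    rw [Finset.sum_comm]
    refine Finset.sum_congr rfl fun x _ => ?_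
    rw [Finset.sum_ite_eq univ (w x)]
    simp
  simp only [h1]
  rw [Finset.sum_comm]
  have h2 : ∀ x : ι, ∑ i, ∑ y,
      (if update w x i y = w x then h (update (update w x i) y i) else 0) = h w := by
    intro x
    rw [Finset.sum_comm, Finset.sum_eq_single x]
    · simp
    · intro y _ hy
      simp only [update_of_ne hy]
      split_ifs
      · exact ht x y w hy.symm
      · simp
    · simp
  simp [h2]

lemma traceless_zero {h : (ι → Fin n) → ℂ} (hi : IsInv h)
    (ht : ∀ (x y : ι) (w : ι → Fin n), x ≠ y → ∑ l, h (update (update w x l) y l) = 0)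
    (h0 : Fintype.card ι ≠ 0) (hn : Fintype.card ι ≠ n) : h = 0 := by
  have hsum : ∑ w, ∑ i, ∑ j, Complex.normSq (E i j h w)
      = ∑ w, (Fintype.card ι : ℝ) * Complex.normSq (h w) := by
    have hc : ∑ w, ∑ i, ∑ j, star (E i j h w) * E i j h w
        = ∑ w, (Fintype.card ι : ℂ) * (star (h w) * h w) := by
      calc ∑ w, ∑ i, ∑ j, star (E i j h w) * E i j h w
          = ∑ i, ∑ j, ∑ w, star (E i j h w) * E i j h w := by
            rw [Finset.sum_comm]
            exact Finset.sum_congr rfl fun i _ => Finset.sum_comm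
        _ = ∑ i, ∑ j, ∑ w, star (h w) * E j i (E j i h) w := by
            refine Finset.sum_congr rfl fun i _ => Finset.sum_congr rfl fun j _ => ?_
            rw [E_adj j i h (E j i h)]
            refine Finset.sum_congr rfl fun w _ => ?_
            rw [hi i j w]
        _ = ∑ w, star (h w) * ∑ i, ∑ j, E j i (E j i h) w := by
            simp only [Finset.mul_sum]
            rw [Finset.sum_comm]
            conv_lhs => rw [Finset.sum_comm]
            conv_rhs => rw [Finset.sum_comm]
            refine Finset.sum_congr rfl fun i _ => Finset.sum_comm
        _ = _ := by
            refine Finset.sum_congr rfl fun w _ => ?_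
            rw [casimir ht w]; ring
    have e : ∀ z : ℂ, ((Complex.normSq z : ℝ) : ℂ) = star z * z := fun z =>
      Complex.normSq_eq_conj_mul_self
    have : ((∑ w, ∑ i, ∑ j, Complex.normSq (E i j h w) : ℝ) : ℂ)
        = ((∑ w, (Fintype.card ι : ℝ) * Complex.normSq (h w) : ℝ) : ℂ) := by
      push_cast
      simp only [e]
      exact hc
    exact_mod_cast this
  let c : (ι → Fin n) → Fin n → ℕ := fun w i => (univ.filter fun x => w x = i).card
  have hdiag : ∀ w i, E i i h w = (c w i : ℂ) * h w := by
    intro w i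
    unfold E
    have : ∀ x, (if w x = i then h (update w x i) else 0) = if w x = i then h w else 0 := by
      intro x
      split_ifs with hx
      · rw [← hx, update_eq_self]
      · rfl
    simp only [this]
    rw [← Finset.sum_filter]
    simp [c]
  have hcs : ∀ w, ∑ i, c w i = Fintype.card ι := by
    intro w
    exact (Finset.card_eq_sum_card_fiberwise (f := w) (s := univ) (t := univ) (by simp)).symm
  have hcs2 : ∀ w, (Fintype.card ι : ℝ) ≤ ∑ i, (c w i : ℝ) ^ 2 := by
    intro w
    rw [← hcs w]
    push_cast
    refine Finset.sum_le_sum fun i _ => ?_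
    exact_mod_cast Nat.le_self_pow (by norm_num) _
  have hd : ∀ w, ∑ i, Complex.normSq (E i i h w) = (∑ i, (c w i : ℝ) ^ 2) * Complex.normSq (h w) := by
    intro w
    rw [Finset.sum_mul]
    refine Finset.sum_congr rfl fun i _ => ?_
    rw [hdiag, map_mul, Complex.normSq_natCast]; ring
  have hrow : ∀ w i, Complex.normSq (E i i h w) ≤ ∑ j, Complex.normSq (E i j h w) := fun w i =>
    Finset.single_le_sum (f := fun j => Complex.normSq (E i j h w))
      (fun j _ => Complex.normSq_nonneg _) (Finset.mem_univ i)
  have hle : ∀ w, (Fintype.card ι : ℝ) * Complex.normSq (h w)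
      ≤ ∑ i, ∑ j, Complex.normSq (E i j h w) := by
    intro w
    refine le_trans (mul_le_mul_of_nonneg_right (hcs2 w) (Complex.normSq_nonneg _)) ?_
    rw [← hd]
    exact Finset.sum_le_sum fun i _ => hrow w i
  have heq : ∀ w, (Fintype.card ι : ℝ) * Complex.normSq (h w)
      = ∑ i, ∑ j, Complex.normSq (E i j h w) := by
    have := (Finset.sum_eq_sum_iff_of_le (s := univ) (fun w _ => hle w)).1 hsum.symm
    exact fun w => this w (Finset.mem_univ w)
  have hinj : ∀ w, h w ≠ 0 → Injective w := by
    intro w hw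
    have hpos : 0 < Complex.normSq (h w) := Complex.normSq_pos.2 hw
    have h1 : ∑ i, (c w i : ℝ) ^ 2 ≤ Fintype.card ι := by
      refine le_of_mul_le_mul_right ?_ hpos
      rw [heq, ← hd]
      exact Finset.sum_le_sum fun i _ => hrow w i
    have h2 : ∑ i, c w i = ∑ i, c w i ^ 2 := by
      apply le_antisymm
      · exact Finset.sum_le_sum fun i _ => Nat.le_self_pow (by norm_num) _
      · rw [hcs]; exact_mod_cast h1
    have h3 := (Finset.sum_eq_sum_iff_of_le (s := univ)
      (fun i _ => Nat.le_self_pow (by norm_num : 2 ≠ 0) (c w i))).1 h2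
    intro x y hxy
    by_contra hne
    have h4 := h3 (w x) (Finset.mem_univ _)
    have h5 : 1 < c w (w x) := Finset.one_lt_card.2 ⟨x, by simp, y, by simp [hxy], hne⟩
    nlinarith
  have hoff : ∀ w i j, i ≠ j → E i j h w = 0 := by
    intro w i j hij
    have h1 : ∑ i, Complex.normSq (E i i h w) = ∑ i, ∑ j, Complex.normSq (E i j h w) := by
      apply le_antisymm
      · exact Finset.sum_le_sum fun i _ => hrow w i
      · rw [← heq, hd]
        exact mul_le_mul_of_nonneg_right (hcs2 w) (Complex.normSq_nonneg _)
    have h2 := (Finset.sum_eq_sum_iff_of_le (s := univ) (fun i _ => hrow w i)).1 h1 i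
      (Finset.mem_univ _)
    rw [← Finset.add_sum_erase univ _ (Finset.mem_univ i)] at h2
    have h3 : ∑ j ∈ univ.erase i, Complex.normSq (E i j h w) = 0 := by linarith
    rw [Finset.sum_eq_zero_iff_of_nonneg (fun w _ => Complex.normSq_nonneg _)] at h3
    simpa using h3 j (by simp [hij.symm])
  funext w
  by_contra hw
  have hw' : h w ≠ 0 := hw
  have inj := hinj w hw'
  have hcard : Fintype.card ι ≤ n := by simpa using Fintype.card_le_of_injective w inj
  have hns : ¬ Surjective w := by
    intro hs
    have := Fintype.card_le_of_surjective w hs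
    simp at this
    omega
  obtain ⟨j, hj⟩ := not_forall.1 hns
  have hj' : ∀ x, w x ≠ j := fun x hx => hj ⟨x, hx⟩
  obtain ⟨x0⟩ : Nonempty ι := Fintype.card_pos_iff.1 (Nat.pos_of_ne_zero h0)
  have := hoff (update w x0 j) j (w x0) (hj' x0).symm
  unfold E at this
  rw [Finset.sum_eq_single x0] at this
  · simp at this; exact hw' this
  · intro y _ hy
    simp [hy, hj']
  · simp

lemma sum_span_zero {g : (ι → Fin n) → ℂ}
    (h : ∀ p : ι → ι, IsMatching p → ∑ w, delta p w * g w = 0) {u : (ι → Fin n) → ℂ}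
    (hu : u ∈ matchSpan ι n) : ∑ w, star (u w) * g w = 0 := by
  unfold matchSpan at hu
  induction hu using Submodule.span_induction with
  | mem u hu =>
    obtain ⟨p, hp, rfl⟩ := hu
    rw [← h p hp]
    refine Finset.sum_congr rfl fun w _ => ?_
    unfold delta
    split_ifs <;> simp
  | zero => simp
  | add u v _ _ hu hv => simp only [Pi.add_apply, star_add, add_mul, Finset.sum_add_distrib, hu, hv, add_zero]
  | smul c u _ hu =>
    simp only [Pi.smul_apply, smul_eq_mul, star_mul', mul_assoc, ← Finset.mul_sum, hu, mul_zero]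

theorem fft (hn : Odd n) (N : ℕ) : ∀ (ι : Type) [Fintype ι] [DecidableEq ι],
    Fintype.card ι = 2 * N → ∀ f : (ι → Fin n) → ℂ, IsInv f → f ∈ matchSpan ι n := by
  induction N with
  | zero =>
    intro ι _ _ hc f _
    have : IsEmpty ι := Fintype.card_eq_zero_iff.1 (by omega)
    have : f = f isEmptyElim • delta (id : ι → ι) := by
      funext w
      have : w = isEmptyElim := Subsingleton.elim _ _
      subst this
      simp [delta]
    rw [this]
    exact Submodule.smul_mem _ _ (Submodule.subset_span
      ⟨id, ⟨fun x => isEmptyElim x, fun x => isEmptyElim x⟩, rfl⟩)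
  | succ N ih =>
    intro ι _ _ hc f hf
    obtain ⟨g, hg, hort⟩ := exists_decomp (matchSpan ι n) f
    have hinv : IsInv (f - g) := by
      intro i j w
      rw [E_sub, E_sub, hf, matchSpan_inv hg]
    have key : f - g = 0 := by
      refine traceless_zero hinv ?_ (by omega) ?_
      · intro a b w hab
        have hco : contr a b (f - g) ∈ matchSpan (Rest a b) n := by
          apply ih _ _ _ (contr_inv hab hinv)
          have := card_rest hab
          omega
        have hz : contr a b (f - g) = 0 := by
          apply eq_zero_of_sum
          refine sum_span_zero ?_ hco
          intro p hp
          rw [sum_contr hab]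
          rw [← hort (delta (extp a b p)) (Submodule.subset_span ⟨_, extp_matching hab hp, rfl⟩)]
          refine Finset.sum_congr rfl fun w _ => ?_
          congr 1
          unfold delta
          split_ifs <;> simp
        have := congrFun hz (fun y => w y)
        simp only [contr, Pi.zero_apply] at this
        rw [← this]
        refine Finset.sum_congr rfl fun l _ => ?_
        refine congrArg (f - g) ?_
        apply fun_ext_ab (a := a) (b := b)
        · simp [ext_a, hab]
        · simp [ext_b hab]
        · intro y
          rw [ext_r, update_of_ne y.2.2, update_of_ne y.2.1]
      · intro h
        rw [← h, hc] at hn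
        exact (Nat.not_odd_iff_even.2 (even_two_mul _)) hn
    rw [sub_eq_zero.1 key]
    exact hg

end main

section matching

lemma two_color {α : Type} {p q : α → α} (hp : IsMatching p) (hq : IsMatching q) :
    ∃ col : α → Bool, ∀ x, col (p x) = !col x ∧ col (q x) = !col x := by
  classical
  let P : Equiv.Perm α := ⟨p, p, hp.1, hp.1⟩
  let Q : Equiv.Perm α := ⟨q, q, hq.1, hq.1⟩
  let t : Equiv.Perm α := P * Q
  have ht : ∀ x, t x = p (q x) := fun x => rfl
  have hconj : Q * t * Q⁻¹ = t⁻¹ := by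
    have hQ : Q⁻¹ = Q := by ext x; rfl
    have hP : P⁻¹ = P := by ext x; rfl
    simp only [t, mul_inv_rev, hP]
    rw [hQ]
    ext x
    simp [Q, P, hq.1]
  have hz : ∀ (l : ℤ) (x : α), q ((t ^ l) x) = (t ^ (-l)) (q x) := by
    intro l x
    have h1 : Q * t ^ l * Q⁻¹ = t ^ (-l) := by
      rw [← conj_zpow, hconj, inv_zpow, zpow_neg]
    rw [← h1]
    have : Q⁻¹ (q x) = x := hq.1 x
    simp only [Equiv.Perm.mul_apply, this]
    rfl
  have hns : ∀ x, ¬ t.SameCycle x (q x) := by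
    rintro x ⟨i, hi⟩
    rcases Int.even_or_odd' i with ⟨l, rfl | rfl⟩
    · apply hq.2 ((t ^ l) x)
      rw [hz, ← hi, ← Equiv.Perm.mul_apply, ← zpow_add]
      congr 2; ring
    · apply hp.2 (q ((t ^ l) x))
      rw [← ht, hz l x, ← hi, ← Equiv.Perm.mul_apply, ← Equiv.Perm.mul_apply, ← zpow_one_add,
        ← zpow_add]
      congr 2; ring
  let O := Quotient (Equiv.Perm.SameCycle.setoid t)
  let orb : α → O := fun x => Quotient.mk _ x
  let _ : LinearOrder O := linearOrderOfSTO WellOrderingRel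
  have horb : ∀ x y, orb x = orb y ↔ t.SameCycle x y := fun x y => Quotient.eq
  have h1 : ∀ x, orb x ≠ orb (q x) := fun x h => hns x ((horb _ _).1 h)
  have h2 : ∀ x, orb (p x) = orb (q x) := by
    intro x
    apply ((horb _ _).2 _).symm
    refine ⟨1, ?_⟩
    simp [ht, hq.1]
  have h3 : ∀ x, orb (q (p x)) = orb x := by
    intro x
    apply ((horb _ _).2 _)
    refine ⟨1, ?_⟩
    simp [ht, hq.1, hp.1]
  refine ⟨fun x => decide (orb x < orb (q x)), fun x => ⟨?_, ?_⟩⟩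
  · simp only [h2, h3]
    rcases lt_or_gt_of_ne (h1 x) with h | h <;> simp [h, h.le]
  · simp only [hq.1]
    rcases lt_or_gt_of_ne (h1 x) with h | h <;> simp [h, h.le]

lemma sum_match {k n : ℕ} {p : Fin k × Bool → Fin k × Bool} (hp : IsMatching p) :
    ∃ (σ : Equiv.Perm (Fin k)) (c : ℂ), ∀ X : Fin k → Matrix (Fin n) (Fin n) ℂ,
      (∀ i, (X i).transpose = - X i) →
      ∑ w : Fin k × Bool → Fin n, delta p w * ∏ a, X a (w (a, false)) (w (a, true))
        = c * ∑ j : Fin k → Fin n, ∏ i, X i (j i) (j (σ i)) := by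
  classical
  have hq : IsMatching (fun x : Fin k × Bool => (x.1, !x.2)) :=
    ⟨fun x => by simp, fun x h => by simpa using congrArg Prod.snd h⟩
  obtain ⟨col, hcol⟩ := two_color hp hq
  have hcp : ∀ x, col (p x) = !col x := fun x => (hcol x).1
  have hcq : ∀ a b, col (a, !b) = !col (a, b) := fun a b => (hcol (a, b)).2
  let e : Fin k → Bool := fun a => !col (a, false)
  let src : Fin k → Fin k × Bool := fun a => (a, e a)
  let tgt : Fin k → Fin k × Bool := fun a => (a, !e a)
  have hcft : ∀ a, col (a, true) = !col (a, false) := fun a => hcq a false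
  have hsrc : ∀ a, col (src a) = true := by
    intro a
    simp only [src, e]
    cases h : col (a, false) <;> simp [h, hcft]
  have htgt : ∀ a, col (tgt a) = false := by
    intro a
    have := hcq a (e a)
    have h2 := hsrc a
    simp only [src] at h2
    simp only [tgt, this, h2, Bool.not_true]
  have hsrc' : ∀ x, col x = true → x = src x.1 := by
    rintro ⟨a, b⟩ h
    simp only [src, e, Prod.mk.injEq, true_and]
    cases b <;> simp_all
  have htgt' : ∀ x, col x = false → x = tgt x.1 := by
    rintro ⟨a, b⟩ h
    simp only [tgt, e, Prod.mk.injEq, true_and]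
    cases b <;> simp_all
  let s : Fin k → Fin k := fun a => (p (tgt a)).1
  have hs : ∀ a, p (tgt a) = src (s a) := by
    intro a
    apply hsrc'
    rw [hcp, htgt]; rfl
  have hsinj : Injective s := by
    intro a b hab
    have h1 : p (tgt a) = p (tgt b) := by rw [hs, hs, hab]
    have h2 : tgt a = tgt b := by rw [← hp.1 (tgt a), h1, hp.1]
    exact congrArg Prod.fst h2
  let σ : Equiv.Perm (Fin k) := Equiv.ofBijective s (Finite.injective_iff_bijective.1 hsinj)
  have hσ : ∀ a, σ a = s a := fun a => rfl
  refine ⟨σ, ∏ a, (if e a then -1 else 1), fun X hX => ?_⟩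
  have hsign : ∀ (w : Fin k × Bool → Fin n) a, X a (w (a, false)) (w (a, true))
      = (if e a then -1 else 1) * X a (w (src a)) (w (tgt a)) := by
    intro w a
    simp only [src, tgt]
    cases h : e a
    · simp
    · have := congrFun (congrFun (hX a) (w (a, true))) (w (a, false))
      simp only [Matrix.transpose_apply, Matrix.neg_apply] at this
      simp [this]
  rw [Finset.mul_sum]
  symm
  let W : (Fin k → Fin n) → (Fin k × Bool → Fin n) := fun j x =>
    if col x then j x.1 else j (s x.1)
  have hWs : ∀ j a, W j (src a) = j a := by
    intro j a; simp only [W, hsrc]; simp [src]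
  have hWt : ∀ j a, W j (tgt a) = j (s a) := by
    intro j a; simp only [W, htgt]; simp [tgt]
  refine Finset.sum_of_injOn W ?_ ?_ ?_ ?_
  · intro j _ j' _ h
    funext a
    rw [← hWs j, h, hWs]
  · intro j _; simp
  · intro w _ hw
    unfold delta
    rw [if_neg, zero_mul]
    intro h
    apply hw
    refine ⟨fun a => w (src a), by simp, ?_⟩
    funext x
    cases hx : col x
    · rw [htgt' x hx]
      have h1 := hWt (fun a => w (src a)) x.1
      simp only [← hs, h] at h1
      exact h1
    · rw [hsrc' x hx]
      exact hWs (fun a => w (src a)) x.1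
  · intro j _
    have hd : delta p (W j) = 1 := by
      unfold delta
      have h0 : ∀ x, col x = false → W j (p x) = W j x := by
        intro x hx
        rw [htgt' x hx, hs, hWs, hWt]
      rw [if_pos]
      intro x
      cases hx : col x
      · exact h0 x hx
      · have := h0 (p x) (by rw [hcp, hx]; rfl)
        rw [hp.1] at this
        exact this.symm
    rw [hd, one_mul, ← Finset.prod_mul_distrib]
    refine Finset.prod_congr rfl fun a _ => ?_
    rw [hsign, hWs, hWt, hσ]

end matching

section so
variable {n : ℕ}

noncomputable def sk (u : Bool → Fin n) : soSubmodule n :=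
  ⟨Matrix.single (u false) (u true) 1 - Matrix.single (u true) (u false) 1, by
    change Matrix.transpose _ = - _
    simp [Matrix.transpose_sub]⟩

lemma sum_sk (G : Matrix (Fin n) (Fin n) ℂ) :
    ((∑ u : Bool → Fin n, G (u false) (u true) • sk u : soSubmodule n) :
      Matrix (Fin n) (Fin n) ℂ) = G - G.transpose := by
  rw [Submodule.coe_sum]
  rw [← Equiv.sum_comp (Equiv.boolArrowEquivProd (Fin n)).symm, Fintype.sum_prod_type]
  simp only [Submodule.coe_smul, sk, Equiv.boolArrowEquivProd, Equiv.coe_fn_symm_mk, smul_sub,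
    Matrix.smul_single, smul_eq_mul, mul_one, Finset.sum_sub_distrib]
  congr 1
  · exact (Matrix.matrix_eq_sum_single G).symm
  · rw [Finset.sum_comm]
    exact (Matrix.matrix_eq_sum_single G.transpose).symm

variable {k : ℕ}

noncomputable def coeff (f : MultilinearMap ℂ (fun _ : Fin k => ↥(soSubmodule n)) ℂ)
    (w : Fin k × Bool → Fin n) : ℂ := f fun a => sk fun b => w (a, b)

lemma expand (f : MultilinearMap ℂ (fun _ : Fin k => ↥(soSubmodule n)) ℂ)
    (c : Fin k → (Bool → Fin n) → ℂ) :
    f (fun a => ∑ u, c a u • sk u) =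
      ∑ w : Fin k × Bool → Fin n, (∏ a, c a fun b => w (a, b)) * coeff f w := by
  classical
  rw [MultilinearMap.map_sum]
  rw [← Equiv.sum_comp (Equiv.curry (Fin k) Bool (Fin n))]
  refine Finset.sum_congr rfl fun w _ => ?_
  rw [MultilinearMap.map_smul_univ]
  rfl

lemma expand_skew (f : MultilinearMap ℂ (fun _ : Fin k => ↥(soSubmodule n)) ℂ)
    (X : Fin k → soSubmodule n) :
    f X = (1 / 2) ^ k * ∑ w : Fin k × Bool → Fin n,
      coeff f w * ∏ a, (X a : Matrix (Fin n) (Fin n) ℂ) (w (a, false)) (w (a, true)) := by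
  have h : X = fun a => ∑ u : Bool → Fin n,
      ((1 / 2 : ℂ) • (X a : Matrix (Fin n) (Fin n) ℂ)) (u false) (u true) • sk u := by
    funext a
    apply Subtype.ext
    rw [sum_sk]
    have : (X a : Matrix (Fin n) (Fin n) ℂ).transpose = - (X a : Matrix (Fin n) (Fin n) ℂ) :=
      (X a).2
    rw [Matrix.transpose_smul, this, smul_neg, sub_neg_eq_add, ← add_smul]
    norm_num
  conv_lhs => rw [h, expand]
  rw [Finset.mul_sum]
  refine Finset.sum_congr rfl fun w _ => ?_
  simp only [Matrix.smul_apply, smul_eq_mul, Finset.prod_mul_distrib, Finset.prod_const,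
    Finset.card_univ, Fintype.card_fin]
  ring

lemma coeff_orth (f : MultilinearMap ℂ (fun _ : Fin k => ↥(soSubmodule n)) ℂ)
    (hn : Odd n)
    (hf : ∀ S : Matrix (Fin n) (Fin n) ℂ, S.transpose * S = 1 → S.det = 1 →
      ∀ X Y : Fin k → ↥(soSubmodule n),
        (∀ i, (Y i : Matrix (Fin n) (Fin n) ℂ) = S * (X i : Matrix (Fin n) (Fin n) ℂ) * S⁻¹) →
        f Y = f X) (S : Matrix (Fin n) (Fin n) ℂ) (hS : S.transpose * S = 1)
    (w : Fin k × Bool → Fin n) :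
    coeff f w = ∑ w', (∏ x, S (w' x) (w x)) * coeff f w' := by
  have hSinv : S⁻¹ = S.transpose := Matrix.inv_eq_left_inv hS
  have hf' : ∀ X Y : Fin k → ↥(soSubmodule n),
        (∀ i, (Y i : Matrix (Fin n) (Fin n) ℂ)
          = S * (X i : Matrix (Fin n) (Fin n) ℂ) * S.transpose) → f Y = f X := by
    intro X Y h
    have hd : S.det = 1 ∨ S.det = -1 := by
      have := congrArg Matrix.det hS
      rw [Matrix.det_mul, Matrix.det_transpose, Matrix.det_one] at this
      exact mul_self_eq_one_iff.1 this
    rcases hd with hd | hd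
    · exact hf S hS hd X Y (by rw [hSinv]; exact h)
    · have h1 : (-S).transpose * (-S) = 1 := by simpa using hS
      refine hf (-S) h1 ?_ X Y ?_
      · rw [Matrix.det_neg, hd, Fintype.card_fin, hn.neg_one_pow]; norm_num
      · rw [Matrix.inv_eq_left_inv h1]
        intro i; rw [h i]; simp
  let G : Fin k → Matrix (Fin n) (Fin n) ℂ := fun a =>
    S * Matrix.single (w (a, false)) (w (a, true)) 1 * S.transpose
  have h1 : coeff f w = f (fun a => ∑ u : Bool → Fin n,
      G a (u false) (u true) • sk u) := by
    symm
    apply hf'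
    intro a
    rw [sum_sk]
    simp only [G, sk, Matrix.transpose_mul, Matrix.transpose_transpose, Matrix.transpose_single]
    rw [Matrix.mul_sub, Matrix.sub_mul, Matrix.mul_assoc S _ S.transpose,
      Matrix.mul_assoc S _ S.transpose]
  rw [h1, expand f (fun a u => G a (u false) (u true))]
  refine Finset.sum_congr rfl fun w' _ => ?_
  rw [Fintype.prod_prod_type]
  congr 1
  refine Finset.prod_congr rfl fun a _ => ?_
  rw [Fintype.prod_bool]
  simp only [G]
  rw [Matrix.mul_assoc, Matrix.mul_apply]
  simp [Matrix.single_mul_apply_of_ne, Matrix.mul_apply, Matrix.single_apply, Finset.sum_ite_eq,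
    ite_and, mul_comm]

lemma sum_erase_update {ι : Type} [Fintype ι] [DecidableEq ι] (F : (ι → Fin n) → ℂ)
    (g : Fin n → ℂ) (w : ι → Fin n) (x : ι) :
    ∑ w' : ι → Fin n, ((∏ y ∈ univ.erase x, (1 : Matrix (Fin n) (Fin n) ℂ) (w' y) (w y))
      * g (w' x)) * F w' = ∑ l, g l * F (update w x l) := by
  symm
  refine Finset.sum_of_injOn (fun l => update w x l) ?_ ?_ ?_ ?_
  · intro l _ m _ h
    exact update_injective w x h
  · intro l _; simp
  · intro w' _ hw'
    have : ∃ y, y ≠ x ∧ w' y ≠ w y := by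
      by_contra hcon
      push Not at hcon
      apply hw'
      refine ⟨w' x, by simp, ?_⟩
      funext y
      by_cases h : y = x
      · subst h; simp
      · simp [h, hcon y h]
    obtain ⟨y, hy, hyw⟩ := this
    have h0 : ∏ y ∈ univ.erase x, (1 : Matrix (Fin n) (Fin n) ℂ) (w' y) (w y) = 0 :=
      Finset.prod_eq_zero (i := y) (by simp [hy]) (Matrix.one_apply_ne hyw)
    simp [h0]
  · intro l _
    rw [Finset.prod_eq_one]
    · simp
    · intro y hy
      have hyx : y ≠ x := by simpa using hy
      rw [update_of_ne hyx]
      exact Matrix.one_apply_eq _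

noncomputable def genA (i j : Fin n) : Matrix (Fin n) (Fin n) ℂ :=
  Matrix.single i j 1 - Matrix.single j i 1
noncomputable def genP (i j : Fin n) : Matrix (Fin n) (Fin n) ℂ :=
  Matrix.single i i 1 + Matrix.single j j 1

noncomputable def rot (i j : Fin n) (θ : ℂ) : Matrix (Fin n) (Fin n) ℂ :=
  1 + (Complex.cos θ - 1) • genP i j + Complex.sin θ • genA i j

lemma rot_orth {i j : Fin n} (hij : i ≠ j) (θ : ℂ) : (rot i j θ).transpose * rot i j θ = 1 := by
  have hPT : (genP i j).transpose = genP i j := by simp [genP]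
  have hAT : (genA i j).transpose = - genA i j := by simp [genA]
  have hPP : genP i j * genP i j = genP i j := by
    simp [genP, Matrix.mul_add, Matrix.add_mul, hij, hij.symm]
  have hPA : genP i j * genA i j = genA i j := by
    simp [genP, genA, Matrix.mul_sub, Matrix.add_mul, hij, hij.symm]
    try abel
  have hAP : genA i j * genP i j = genA i j := by
    simp [genP, genA, Matrix.mul_add, Matrix.sub_mul, hij, hij.symm]
    try abel
  have hAA : genA i j * genA i j = - genP i j := by
    simp [genP, genA, Matrix.mul_sub, Matrix.sub_mul, hij, hij.symm]
    try abel
  have hsc := Complex.sin_sq_add_cos_sq θ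
  unfold rot
  simp only [Matrix.transpose_add, Matrix.transpose_smul, Matrix.transpose_one, hPT, hAT,
    Matrix.mul_add, Matrix.add_mul, Matrix.smul_mul, Matrix.mul_smul, Matrix.neg_mul, hPP, hPA,
    hAP, hAA, Matrix.one_mul, Matrix.mul_one, smul_neg, neg_neg, smul_add, smul_smul]
  have : (Complex.sin θ * Complex.sin θ) • genP i j
      = (1 - Complex.cos θ * Complex.cos θ) • genP i j := by
    congr 1; linear_combination hsc
  rw [this]
  module

lemma coeff_inv (f : MultilinearMap ℂ (fun _ : Fin k => ↥(soSubmodule n)) ℂ)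
    (hn : Odd n)
    (hf : ∀ S : Matrix (Fin n) (Fin n) ℂ, S.transpose * S = 1 → S.det = 1 →
      ∀ X Y : Fin k → ↥(soSubmodule n),
        (∀ i, (Y i : Matrix (Fin n) (Fin n) ℂ) = S * (X i : Matrix (Fin n) (Fin n) ℂ) * S⁻¹) →
        f Y = f X) : IsInv (coeff f) := by
  intro i j w
  by_cases hij : i = j
  · rw [hij]
  have hent : ∀ l m, HasDerivAt (fun θ => rot i j θ l m) (genA i j l m) 0 := by
    intro l m
    have h1 := ((Complex.hasDerivAt_cos 0).sub_const 1).mul_const (genP i j l m)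
    have h2 := (Complex.hasDerivAt_sin 0).mul_const (genA i j l m)
    have h3 := (h1.const_add ((1 : Matrix (Fin n) (Fin n) ℂ) l m)).add h2
    simp at h3
    exact h3
  have hr0 : rot i j 0 = 1 := by simp [rot]
  have hder : HasDerivAt (fun θ => ∑ w', (∏ x, rot i j θ (w' x) (w x)) * coeff f w')
      (∑ w', (∑ x, (∏ y ∈ univ.erase x, rot i j 0 (w' y) (w y)) * genA i j (w' x) (w x))
        * coeff f w') 0 := by
    refine HasDerivAt.fun_sum fun w' _ => ?_
    refine HasDerivAt.mul_const ?_ _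
    have := HasDerivAt.fun_finsetProd (u := univ) (x := (0 : ℂ))
      (f := fun x θ => rot i j θ (w' x) (w x)) (fun x _ => hent (w' x) (w x))
    simpa using this
  have hconst : (fun θ => ∑ w', (∏ x, rot i j θ (w' x) (w x)) * coeff f w')
      = fun _ => coeff f w := by
    funext θ
    exact (coeff_orth f hn hf _ (rot_orth hij θ) w).symm
  rw [hconst] at hder
  have h0 := hder.unique (hasDerivAt_const _ _)
  rw [hr0] at h0
  simp only [Finset.sum_mul] at h0
  rw [Finset.sum_comm] at h0
  have h1 : ∀ x, ∑ w' : Fin k × Bool → Fin n,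
      ((∏ y ∈ univ.erase x, (1 : Matrix (Fin n) (Fin n) ℂ) (w' y) (w y))
      * genA i j (w' x) (w x)) * coeff f w' =
      (if w x = j then coeff f (update w x i) else 0) -
      (if w x = i then coeff f (update w x j) else 0) := by
    intro x
    rw [sum_erase_update (coeff f) (fun l => genA i j l (w x)) w x]
    simp only [genA, Matrix.sub_apply, Matrix.single_apply, sub_mul, Finset.sum_sub_distrib,
      ite_and, ite_mul, zero_mul, one_mul, Finset.sum_ite_eq, Finset.mem_univ, if_true,
      eq_comm (a := w x)]
  simp only [h1, Finset.sum_sub_distrib] at h0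
  exact (sub_eq_zero.1 h0).symm

end so

end SOInv

theorem invariant_multilinear_so_odd_mem_span_trace_monomials
    (r k : ℕ) (hr : 1 ≤ r)
    (f : MultilinearMap ℂ (fun _ : Fin k => ↥(soSubmodule (2 * r + 1))) ℂ)
    (hf : ∀ S : Matrix (Fin (2 * r + 1)) (Fin (2 * r + 1)) ℂ,
      S.transpose * S = 1 → S.det = 1 →
      ∀ X Y : Fin k → ↥(soSubmodule (2 * r + 1)),
        (∀ i, (Y i : Matrix (Fin (2 * r + 1)) (Fin (2 * r + 1)) ℂ)
            = S * (X i : Matrix (Fin (2 * r + 1)) (Fin (2 * r + 1)) ℂ) * S⁻¹) →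
        f Y = f X) :
    ⇑f ∈ Submodule.span ℂ
      {h : (Fin k → ↥(soSubmodule (2 * r + 1))) → ℂ |
        ∃ σ : Equiv.Perm (Fin k),
          h = fun X => ∑ j : Fin k → Fin (2 * r + 1), ∏ i : Fin k,
            (X i : Matrix (Fin (2 * r + 1)) (Fin (2 * r + 1)) ℂ) (j i) (j (σ i))} := by
  have hn : Odd (2 * r + 1) := odd_two_mul_add_one r
  have hmem := SOInv.fft hn k (Fin k × Bool) (by simp [mul_comm]) _ (SOInv.coeff_inv f hn hf)
  have key : ∀ g ∈ SOInv.matchSpan (Fin k × Bool) (2 * r + 1),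
      (fun X : Fin k → ↥(soSubmodule (2 * r + 1)) => ∑ w : Fin k × Bool → Fin (2 * r + 1),
        g w * ∏ a, (X a : Matrix (Fin (2 * r + 1)) (Fin (2 * r + 1)) ℂ)
          (w (a, false)) (w (a, true))) ∈ Submodule.span ℂ
      {h : (Fin k → ↥(soSubmodule (2 * r + 1))) → ℂ |
        ∃ σ : Equiv.Perm (Fin k),
          h = fun X => ∑ j : Fin k → Fin (2 * r + 1), ∏ i : Fin k,
            (X i : Matrix (Fin (2 * r + 1)) (Fin (2 * r + 1)) ℂ) (j i) (j (σ i))} := by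
    intro g hg
    unfold SOInv.matchSpan at hg
    induction hg using Submodule.span_induction with
    | mem g hg =>
      obtain ⟨p, hp, rfl⟩ := hg
      obtain ⟨σ, c, h⟩ := SOInv.sum_match (n := 2 * r + 1) hp
      have h2 := Submodule.smul_mem _ c (Submodule.subset_span (R := ℂ)
        (s := {h : (Fin k → ↥(soSubmodule (2 * r + 1))) → ℂ |
        ∃ σ : Equiv.Perm (Fin k),
          h = fun X => ∑ j : Fin k → Fin (2 * r + 1), ∏ i : Fin k,
            (X i : Matrix (Fin (2 * r + 1)) (Fin (2 * r + 1)) ℂ) (j i) (j (σ i))}) ⟨σ, rfl⟩)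
      convert h2 using 1
      funext X
      exact h (fun a => X a) (fun a => (X a).2)
    | zero =>
      convert Submodule.zero_mem _ using 1
      funext X; simp
    | add u v _ _ hu hv =>
      convert Submodule.add_mem _ hu hv using 1
      funext X
      simp only [Pi.add_apply, add_mul, Finset.sum_add_distrib]
    | smul c u _ hu =>
      convert Submodule.smul_mem _ c hu using 1
      funext X
      simp only [Pi.smul_apply, smul_eq_mul, mul_assoc, Finset.mul_sum]
  have h := Submodule.smul_mem _ ((1 / 2 : ℂ) ^ k) (key _ hmem)
  convert h using 1
  funext X
  exact SOInv.expand_skew f X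
end

section
/- Let r ≥ 1, let J be the standard 2r×2r complex symplectic matrix (the invertible skew-symmetric block matrix [[0, −1],[1, 0]]), and let k ≥ 0. Let f be a k-multilinear ℂ-valued map on sp(2r,ℂ) = {X : Matrix (Fin (2r)) (Fin (2r)) ℂ | Xᵀ J = −J X} such that f(S X₁ S⁻¹, …, S X_k S⁻¹) = f(X₁, …, X_k) for every S in Sp(2r,ℂ) = {S | Sᵀ J S = J} and all X₁,…,X_k in sp(2r,ℂ). Then f lies in the ℂ-linear span of the restrictions to sp(2r,ℂ) of the trace monomials T_σ, as σ ranges over all permutations of {1,…,k}. -/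
/-!
STATEMENT 2 (C_r case of the main theorem): every `Sp(2r,ℂ)`-invariant `k`-multilinear
map on `sp(2r,ℂ)` lies in the ℂ-span of (restrictions of) trace monomials `T_σ`.

For a permutation `σ` of `Fin k`, the trace monomial is realized by the standard
entry formula `T_σ (X₁,…,X_k) = ∑_{j} ∏ i, (X i) (j i) (j (σ i))`, which equals the
product over the cycles `(i₁ … i_m)` of `σ` of `tr (X_{i₁} ⋯ X_{i_m})`.
-/

/-- The standard `2r × 2r` complex symplectic matrix, with block form `[[0, -1], [1, 0]]`. -/
noncomputable def stdSymplecticMatrix (r : ℕ) : Matrix (Fin (2 * r)) (Fin (2 * r)) ℂ :=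
  Matrix.reindex (((finSumFinEquiv : Fin r ⊕ Fin r ≃ Fin (r + r)).trans
      (finCongr (by omega))) : Fin r ⊕ Fin r ≃ Fin (2 * r))
    ((finSumFinEquiv : Fin r ⊕ Fin r ≃ Fin (r + r)).trans (finCongr (by omega)))
    (Matrix.fromBlocks 0 (-1) 1 0)

/-- The symplectic Lie algebra `sp(2r,ℂ) = {X | Xᵀ J = -J X}` as a submodule of
the space of `2r × 2r` complex matrices. -/
noncomputable def spSubmodule (r : ℕ) : Submodule ℂ (Matrix (Fin (2 * r)) (Fin (2 * r)) ℂ) where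
  carrier := {X | X.transpose * stdSymplecticMatrix r = -(stdSymplecticMatrix r * X)}
  add_mem' := by
    intro a b ha hb
    simp only [Set.mem_setOf_eq] at *
    rw [Matrix.transpose_add, add_mul, ha, hb, mul_add, neg_add]
  zero_mem' := by simp
  smul_mem' := by
    intro c a ha
    simp only [Set.mem_setOf_eq] at *
    rw [Matrix.transpose_smul, smul_mul_assoc, ha, mul_smul_comm, smul_neg]


namespace SpFFT

open Finset Function

/-- Raising operator: the total action of an elementary matrix on the slots in `S`. -/
noncomputable def raise {ι : Type*} [DecidableEq ι] {N : ℕ} (S : Finset ι) (c d : Fin N)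
    (t : (ι → Fin N) → ℂ) : (ι → Fin N) → ℂ :=
  fun α => ∑ i ∈ S, if α i = c then t (update α i d) else 0

/-- `N + 1` plus the Jucys Murphy element at slot `i0`. -/
noncomputable def jmOp {ι : Type*} [DecidableEq ι] {N : ℕ} (S : Finset ι) (i0 : ι) :
    ((ι → Fin N) → ℂ) →ₗ[ℂ] ((ι → Fin N) → ℂ) where
  toFun t := fun α => ((N : ℂ) + 1) * t α + ∑ j ∈ S.erase i0, t (α ∘ Equiv.swap i0 j)
  map_add' t u := by
    funext α
    simp only [Pi.add_apply, sum_add_distrib]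
    ring
  map_smul' c t := by
    funext α
    simp only [Pi.smul_apply, smul_eq_mul, RingHom.id_apply, ← mul_sum]
    ring

lemma jmOp_apply {ι : Type*} [DecidableEq ι] {N : ℕ} (S : Finset ι) (i0 : ι)
    (t : (ι → Fin N) → ℂ) (α : ι → Fin N) :
    jmOp S i0 t α = ((N : ℂ) + 1) * t α + ∑ j ∈ S.erase i0, t (α ∘ Equiv.swap i0 j) := rfl

lemma swap_mem_iff {ι : Type*} [DecidableEq ι] {S : Finset ι} {p q : ι} (hp : p ∈ S)
    (hq : q ∈ S) (x : ι) : Equiv.swap p q x ∈ S ↔ x ∈ S := by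
  by_cases h1 : x = p
  · subst h1; simp [hp, hq]
  by_cases h2 : x = q
  · subst h2; simp [hp, hq]
  rw [Equiv.swap_apply_of_ne_of_ne h1 h2]

lemma raise_swap {ι : Type*} [DecidableEq ι] {N : ℕ} (S : Finset ι) (c d : Fin N)
    (t : (ι → Fin N) → ℂ) {p q : ι} (hp : p ∈ S) (hq : q ∈ S) (α : ι → Fin N) :
    raise S c d t (α ∘ Equiv.swap p q) = raise S c d (fun β => t (β ∘ Equiv.swap p q)) α := by
  unfold raise
  refine Finset.sum_equiv (Equiv.swap p q) (fun i => (swap_mem_iff hp hq i).symm) ?_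
  intro i _
  have : update (α ∘ Equiv.swap p q) i d
      = (update α (Equiv.swap p q i) d) ∘ Equiv.swap p q := by
    funext x
    by_cases hx : x = i
    · subst hx; simp
    · have : Equiv.swap p q x ≠ Equiv.swap p q i := fun h => hx ((Equiv.swap p q).injective h)
      simp [hx, this]
  simp only [comp_apply, this]

lemma jmOp_raise {ι : Type*} [DecidableEq ι] {N : ℕ} (S : Finset ι) {i0 : ι} (h0 : i0 ∈ S)
    (c d : Fin N) (t : (ι → Fin N) → ℂ) :
    jmOp S i0 (raise S c d t) = raise S c d (jmOp S i0 t) := by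
  funext α
  rw [jmOp_apply]
  rw [Finset.sum_congr rfl (fun j hj => raise_swap S c d t h0 (mem_of_mem_erase hj) α)]
  simp only [raise, jmOp_apply]
  rw [sum_comm, mul_sum, ← sum_add_distrib]
  refine sum_congr rfl fun i _ => ?_
  split_ifs <;> simp

lemma swap_eq_update {ι : Type*} [DecidableEq ι] {I : Type*} (α : ι → I) {i j : ι} (h : j ≠ i) :
    α ∘ Equiv.swap i j = update (update α i (α j)) j (α i) := by
  funext x
  by_cases h1 : x = j
  · subst h1; simp
  by_cases h2 : x = i
  · subst h2; simp [h1]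
  simp [h1, h2, Equiv.swap_apply_of_ne_of_ne h2 h1]

/-- Injectivity of the shifted Jucys Murphy operator, by a highest weight argument. -/
lemma jmOp_ker {ι : Type*} [DecidableEq ι] {N : ℕ} (S : Finset ι) {i0 : ι} (h0 : i0 ∈ S) :
    ∀ (h : ℕ) (t : (ι → Fin N) → ℂ), jmOp S i0 t = 0 →
      ∀ α : ι → Fin N, ∑ i ∈ S, (α i : ℕ) = h → t α = 0 := by
  intro h
  induction h using Nat.strong_induction_on with
  | _ h ih =>
  intro t ht
  have hlow : ∀ c d : Fin N, ∀ α : ι → Fin N, ∑ i ∈ S, (α i : ℕ) < h → raise S c d t α = 0 := by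
    intro c d α hα
    refine ih _ hα (raise S c d t) ?_ α rfl
    rw [jmOp_raise S h0, ht]
    funext β
    simp [raise]
  suffices H : ∀ n : ℕ, ∀ α : ι → Fin N, N - (α i0 : ℕ) = n → ∑ i ∈ S, (α i : ℕ) = h → t α = 0 from
    fun α hα => H _ α rfl hα
  intro n
  induction n using Nat.strong_induction_on with
  | _ n ihn =>
  intro α hn hα
  have key := congrFun ht α
  rw [jmOp_apply, Pi.zero_apply] at key
  rw [← Finset.sum_fiberwise (S.erase i0) (fun j => α j)] at key
  have hb : ∀ b : Fin N, ∑ j ∈ S.erase i0 with α j = b, t (α ∘ Equiv.swap i0 j) =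
      (if b < α i0 then -1 else if b = α i0 then
        (#{j ∈ S.erase i0 | α j = α i0} : ℂ) else 0) * t α := by
    intro b
    rcases lt_trichotomy b (α i0) with hlt | heq | hgt
    · rw [if_pos hlt]
      have hsum : ∑ i ∈ S, (update α i0 b i : ℕ) < h := by
        rw [← hα]
        refine Finset.sum_lt_sum ?_ ⟨i0, h0, ?_⟩
        · intro i _
          by_cases hi : i = i0
          · subst hi; simpa using hlt.le
          · simp [hi]
        · simpa using hlt
      have e := hlow b (α i0) _ hsum
      unfold raise at e
      rw [← Finset.add_sum_erase S _ h0] at e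
      simp only [update_self, if_true, update_idem, update_eq_self] at e
      have e2 : ∑ j ∈ S.erase i0 with α j = b, t (α ∘ Equiv.swap i0 j) =
          ∑ x ∈ S.erase i0, if update α i0 b x = b then t (update (update α i0 b) x (α i0)) else 0 := by
        rw [Finset.sum_filter]
        refine sum_congr rfl fun x hx => ?_
        have hx' := ne_of_mem_erase hx
        rw [update_of_ne hx']
        split_ifs with hxb
        · rw [swap_eq_update α hx', hxb]
        · rfl
      rw [e2]
      linear_combination e
    · subst heq
      rw [if_neg (lt_irrefl _), if_pos rfl, ← nsmul_eq_mul]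
      apply Finset.sum_eq_card_nsmul
      intro j hj
      rw [mem_filter] at hj
      rw [swap_eq_update α (ne_of_mem_erase hj.1), hj.2]
      simp
      rw [← hj.2]; simp
    · rw [if_neg hgt.not_gt, if_neg hgt.ne', zero_mul]
      apply Finset.sum_eq_zero
      intro j hj
      rw [mem_filter] at hj
      refine ihn _ ?_ (α ∘ Equiv.swap i0 j) rfl ?_
      · simp only [comp_apply, Equiv.swap_apply_left, hj.2]
        have := (α i0).2
        have := b.2
        have : (α i0 : ℕ) < b := hgt
        omega
      · rw [← hα]
        exact Finset.sum_equiv (Equiv.swap i0 j)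
          (fun i => (swap_mem_iff h0 (mem_of_mem_erase hj.1) i).symm) (fun i _ => rfl)
  rw [Finset.sum_congr rfl (fun b _ => hb b), ← Finset.sum_mul, ← add_mul] at key
  rcases mul_eq_zero.mp key with hk | hk
  · exfalso
    have e3 : ∑ b : Fin N, (if b < α i0 then (-1 : ℂ) else if b = α i0 then
        (#{j ∈ S.erase i0 | α j = α i0} : ℂ) else 0) =
        -((α i0 : ℕ) : ℂ) + (#{j ∈ S.erase i0 | α j = α i0} : ℂ) := by
      have : ∀ b : Fin N, (if b < α i0 then (-1 : ℂ) else if b = α i0 then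
        (#{j ∈ S.erase i0 | α j = α i0} : ℂ) else 0) = (if b < α i0 then (-1 : ℂ) else 0) +
          (if b = α i0 then (#{j ∈ S.erase i0 | α j = α i0} : ℂ) else 0) := by
        intro b
        by_cases h1 : b < α i0
        · simp [h1, h1.ne]
        · simp [h1]
      rw [Finset.sum_congr rfl (fun b _ => this b), Finset.sum_add_distrib]
      congr 1
      · rw [← Finset.sum_filter, Finset.sum_const]
        have hc : (univ.filter fun a : Fin N => a < α i0) = Finset.Iio (α i0) := by
          ext a; simp
        rw [hc, Fin.card_Iio]
        simp
      · simp
    rw [e3] at hk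
    have h5 : ((N + 1 + #{j ∈ S.erase i0 | α j = α i0} : ℕ) : ℂ) = ((α i0 : ℕ) : ℂ) := by
      push_cast
      linear_combination hk
    have h6 := Nat.cast_injective h5
    have := (α i0).2
    omega
  · exact hk

lemma jmOp_injective {ι : Type*} [DecidableEq ι] {N : ℕ} (S : Finset ι) {i0 : ι} (h0 : i0 ∈ S) :
    Injective (jmOp (N := N) S i0) := by
  rw [← LinearMap.ker_eq_bot, LinearMap.ker_eq_bot']
  intro t ht
  funext α
  exact jmOp_ker S h0 _ t ht α rfl

end SpFFT

namespace SpFFT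

open Finset Function

/-- Matching monomials on the slots in `S`. -/
inductive Mono {ι : Type*} [DecidableEq ι] {N : ℕ} (J : Matrix (Fin N) (Fin N) ℂ) :
    Finset ι → ((ι → Fin N) → ℂ) → Prop
  | empty : Mono J ∅ (fun _ => 1)
  | step (S : Finset ι) (m : (ι → Fin N) → ℂ) (i j : ι) (hij : i ≠ j) (hi : i ∉ S) (hj : j ∉ S)
      (hm : Mono J S m) : Mono J (insert i (insert j S)) (fun α => J (α i) (α j) * m α)

lemma Mono.perm {ι : Type*} [DecidableEq ι] {N : ℕ} {J : Matrix (Fin N) (Fin N) ℂ}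
    {S : Finset ι} {m : (ι → Fin N) → ℂ} (h : Mono J S m) (σ : Equiv.Perm ι) :
    Mono J (S.map σ.toEmbedding) (fun α => m (α ∘ σ)) := by
  induction h with
  | empty => simpa using Mono.empty
  | step S m i j hij hi hj hm ih =>
    have := Mono.step _ _ (σ i) (σ j) (fun h => hij (σ.injective h)) (by simpa using hi)
      (by simpa using hj) ih
    simpa [Finset.map_insert] using this

/-- `t` only depends on the slots in `S` and is annihilated by the symplectic Lie algebra. -/
structure Inv {ι : Type*} [DecidableEq ι] {N : ℕ} (J : Matrix (Fin N) (Fin N) ℂ)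
    (S : Finset ι) (t : (ι → Fin N) → ℂ) : Prop where
  indep : ∀ i ∉ S, ∀ α a, t (update α i a) = t α
  inv : ∀ α a b, ∑ i ∈ S, (J b (α i) * t (update α i a) + J a (α i) * t (update α i b)) = 0

/-- Contraction of the slots `i`, `j`. -/
noncomputable def contr {ι : Type*} [DecidableEq ι] {N : ℕ} (Q : Matrix (Fin N) (Fin N) ℂ)
    (i j : ι) (t : (ι → Fin N) → ℂ) : (ι → Fin N) → ℂ :=
  fun α => ∑ c, ∑ d, Q c d * t (update (update α i c) j d)

lemma Inv.contr {ι : Type*} [DecidableEq ι] {N : ℕ} {J Q : Matrix (Fin N) (Fin N) ℂ}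
    (hJ : ∀ a b, J a b = - J b a) (hJQ : J * Q = 1) (hQJ : Q * J = 1)
    {S : Finset ι} {t : (ι → Fin N) → ℂ} (h : Inv J S t) {i j : ι} (hi : i ∈ S) (hj : j ∈ S)
    (hij : j ≠ i) : Inv J ((S.erase i).erase j) (contr Q i j t) := by
  constructor
  · intro x hx α a
    unfold SpFFT.contr
    refine sum_congr rfl fun c _ => sum_congr rfl fun d _ => ?_
    congr 1
    by_cases hxj : x = j
    · subst hxj
      rw [update_comm hij, update_idem, update_comm hij.symm]
    by_cases hxi : x = i
    · subst hxi
      rw [update_idem]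
    rw [update_comm hxi, update_comm hxj]
    refine h.indep x ?_ _ _
    intro hS
    exact hx (by simp [hxj, hxi, hS])
  · intro α a b
    have hJQ' : ∀ a b, ∑ c, J a c * Q c b = if a = b then 1 else 0 := by
      intro a b
      have := congrFun (congrFun hJQ a) b
      rwa [Matrix.mul_apply, Matrix.one_apply] at this
    have hQJ' : ∀ a b, ∑ c, Q a c * J b c = - if a = b then 1 else 0 := by
      intro a b
      have := congrFun (congrFun hQJ a) b
      rw [Matrix.mul_apply, Matrix.one_apply] at this
      rw [← this, ← sum_neg_distrib]
      refine sum_congr rfl fun c _ => ?_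
      rw [hJ b c]; ring
    have key : ∀ c d, ∑ x ∈ (S.erase i).erase j,
        (J b (α x) * t (update (update (update α x a) i c) j d)
          + J a (α x) * t (update (update (update α x b) i c) j d))
        = - (J b c * t (update (update α i a) j d) + J a c * t (update (update α i b) j d)
          + J b d * t (update (update α i c) j a) + J a d * t (update (update α i c) j b)) := by
      intro c d
      have e := h.inv (update (update α i c) j d) a b
      rw [← Finset.add_sum_erase S _ hi,
        ← Finset.add_sum_erase (S.erase i) _ (mem_erase.mpr ⟨hij, hj⟩)] at e
      have e2 : ∑ x ∈ (S.erase i).erase j,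
        (J b (α x) * t (update (update (update α x a) i c) j d)
          + J a (α x) * t (update (update (update α x b) i c) j d)) =
          ∑ x ∈ (S.erase i).erase j, (J b (update (update α i c) j d x) *
            t (update (update (update α i c) j d) x a) + J a (update (update α i c) j d x) *
            t (update (update (update α i c) j d) x b)) := by
        refine sum_congr rfl fun x hx => ?_
        have hxj := ne_of_mem_erase hx
        have hxi := ne_of_mem_erase (mem_of_mem_erase hx)
        rw [update_of_ne hxj, update_of_ne hxi, update_comm hxi, update_comm hxj,
          update_comm hxi, update_comm hxj]
      rw [e2]
      have u1 : ∀ a, update (update (update α i c) j d) i a = update (update α i a) j d := by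
        intro a
        rw [update_comm hij, update_idem]
      simp only [u1, update_self, update_idem, update_of_ne hij.symm] at e
      linear_combination e
    have e3 : ∑ x ∈ (S.erase i).erase j, (J b (α x) * SpFFT.contr Q i j t (update α x a)
        + J a (α x) * SpFFT.contr Q i j t (update α x b)) =
        ∑ c, ∑ d, Q c d * ∑ x ∈ (S.erase i).erase j,
        (J b (α x) * t (update (update (update α x a) i c) j d)
          + J a (α x) * t (update (update (update α x b) i c) j d)) := by
      simp only [SpFFT.contr, mul_sum, ← sum_add_distrib]
      rw [sum_comm]
      refine sum_congr rfl fun c _ => ?_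
      rw [sum_comm]
      refine sum_congr rfl fun d _ => sum_congr rfl fun x _ => ?_
      ring
    rw [e3]
    simp only [key]
    have e4 : ∀ a b, ∑ c, ∑ d, Q c d * (J b c * t (update (update α i a) j d))
        = t (update (update α i a) j b) := by
      intro a b
      rw [sum_comm]
      have : ∀ d, ∑ c, Q c d * (J b c * t (update (update α i a) j d)) =
          (if b = d then 1 else 0) * t (update (update α i a) j d) := by
        intro d
        rw [← hJQ', sum_mul]
        exact sum_congr rfl fun c _ => by ring
      simp [this]
    have e5 : ∀ a b, ∑ c, ∑ d, Q c d * (J b d * t (update (update α i c) j a))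
        = - t (update (update α i b) j a) := by
      intro a b
      have : ∀ c, ∑ d, Q c d * (J b d * t (update (update α i c) j a)) =
          (- if c = b then 1 else 0) * t (update (update α i c) j a) := by
        intro c
        rw [← hQJ', sum_mul]
        exact sum_congr rfl fun c _ => by ring
      simp [this]
    simp only [mul_neg, mul_add, sum_neg_distrib, sum_add_distrib, e4, e5]
    ring

/-- The Casimir identity. -/
lemma Inv.casimir {ι : Type*} [DecidableEq ι] {N : ℕ} {J Q : Matrix (Fin N) (Fin N) ℂ}
    (hJQ : J * Q = 1) (hQJ : Q * J = 1)
    {S : Finset ι} {t : (ι → Fin N) → ℂ} (h : Inv J S t) {i : ι} (hi : i ∈ S) :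
    jmOp S i t = - ∑ j ∈ S.erase i, fun α => J (α i) (α j) * SpFFT.contr Q i j t α := by
  funext α
  rw [jmOp_apply]
  have hJQ' : ∀ a b, ∑ c, J a c * Q c b = if a = b then 1 else 0 := by
    intro a b
    have := congrFun (congrFun hJQ a) b
    rwa [Matrix.mul_apply, Matrix.one_apply] at this
  have hQJ' : ∀ a b, ∑ c, Q a c * J c b = if a = b then 1 else 0 := by
    intro a b
    have := congrFun (congrFun hQJ a) b
    rwa [Matrix.mul_apply, Matrix.one_apply] at this
  have e : ∀ c b, (J b c * t α + J (α i) c * t (update α i b)) +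
      ∑ j ∈ S.erase i, (J b (α j) * t (update (update α i c) j (α i)) +
        J (α i) (α j) * t (update (update α i c) j b)) = 0 := by
    intro c b
    have e := h.inv (update α i c) (α i) b
    rw [← Finset.add_sum_erase S _ hi] at e
    simp only [update_self, update_idem, update_eq_self] at e
    rw [← e]
    congr 1
    refine sum_congr rfl fun j hj => ?_
    rw [update_of_ne (ne_of_mem_erase hj)]
  have e0 : ∑ c, ∑ b, Q c b * ((J b c * t α + J (α i) c * t (update α i b)) +
      ∑ j ∈ S.erase i, (J b (α j) * t (update (update α i c) j (α i)) +
        J (α i) (α j) * t (update (update α i c) j b))) = 0 := by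
    simp [e]
  have f1 : ∑ c, ∑ b, Q c b * (J b c * t α) = N * t α := by
    have : ∀ c, ∑ b, Q c b * (J b c * t α) = t α := by
      intro c
      have := hQJ' c c
      rw [if_pos rfl] at this
      calc _ = (∑ b, Q c b * J b c) * t α := by
            rw [sum_mul]; exact sum_congr rfl fun _ _ => by ring
        _ = _ := by rw [this, one_mul]
    simp [this]
  have f2 : ∑ c, ∑ b, Q c b * (J (α i) c * t (update α i b)) = t α := by
    rw [sum_comm]
    have : ∀ b, ∑ c, Q c b * (J (α i) c * t (update α i b)) =
        (if α i = b then 1 else 0) * t (update α i b) := by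
      intro b
      rw [← hJQ', sum_mul]
      exact sum_congr rfl fun c _ => by ring
    simp [this]
  have f3 : ∀ j ∈ S.erase i, ∑ c, ∑ b, Q c b * (J b (α j) * t (update (update α i c) j (α i)) +
        J (α i) (α j) * t (update (update α i c) j b)) =
        t (α ∘ Equiv.swap i j) + J (α i) (α j) * SpFFT.contr Q i j t α := by
    intro j hj
    simp only [mul_add, sum_add_distrib]
    congr 1
    · rw [swap_eq_update α (ne_of_mem_erase hj)]
      have : ∀ c, ∑ b, Q c b * (J b (α j) * t (update (update α i c) j (α i))) =
          (if c = α j then 1 else 0) * t (update (update α i c) j (α i)) := by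
        intro c
        rw [← hQJ', sum_mul]
        exact sum_congr rfl fun _ _ => by ring
      simp [this]
    · simp only [SpFFT.contr, mul_sum]
      exact sum_congr rfl fun _ _ => sum_congr rfl fun _ _ => by ring
  have f4 : ∑ c, ∑ b, Q c b * ∑ j ∈ S.erase i,
      (J b (α j) * t (update (update α i c) j (α i)) +
        J (α i) (α j) * t (update (update α i c) j b)) = ∑ j ∈ S.erase i,
        (t (α ∘ Equiv.swap i j) + J (α i) (α j) * SpFFT.contr Q i j t α) := by
    rw [← sum_congr rfl f3]
    symm
    rw [sum_comm]
    refine sum_congr rfl fun c _ => ?_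
    rw [sum_comm]
    exact sum_congr rfl fun b _ => by rw [mul_sum]
  have f0 : ∑ c, ∑ b, Q c b * ((J b c * t α + J (α i) c * t (update α i b)) +
      ∑ j ∈ S.erase i, (J b (α j) * t (update (update α i c) j (α i)) +
        J (α i) (α j) * t (update (update α i c) j b))) = N * t α + t α + ∑ j ∈ S.erase i,
        (t (α ∘ Equiv.swap i j) + J (α i) (α j) * SpFFT.contr Q i j t α) := by
    rw [← f4]
    generalize (fun c b => ∑ j ∈ S.erase i,
      (J b (α j) * t (update (update α i c) j (α i)) +
        J (α i) (α j) * t (update (update α i c) j b))) = G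
    simp only [mul_add (Q _ _), sum_add_distrib, f1, f2]
  rw [f0, sum_add_distrib] at e0
  simp only [Pi.neg_apply, Finset.sum_apply]
  linear_combination e0

/-- First fundamental theorem for the symplectic group, tensor form. -/
theorem fft {ι : Type*} [DecidableEq ι] [Fintype ι] {N : ℕ} {J Q : Matrix (Fin N) (Fin N) ℂ}
    (hJ : ∀ a b, J a b = - J b a) (hJQ : J * Q = 1) (hQJ : Q * J = 1) :
    ∀ (n : ℕ) (S : Finset ι) (t : (ι → Fin N) → ℂ), #S = n → Inv J S t →
      t ∈ Submodule.span ℂ {m | Mono J S m} := by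
  intro n
  induction n using Nat.strong_induction_on with
  | _ n ih =>
  intro S t hS ht
  rcases S.eq_empty_or_nonempty with rfl | ⟨i, hi⟩
  · by_cases hne : Nonempty (ι → Fin N)
    · obtain ⟨α0⟩ := hne
      have hpc : ∀ (U : Finset ι) (α : ι → Fin N), t (U.piecewise α α0) = t α0 := by
        intro U α
        induction U using Finset.induction_on with
        | empty => simp
        | insert x U hx ihU => rw [Finset.piecewise_insert, ht.indep x (by simp), ihU]
      have : t = t α0 • (fun _ => (1 : ℂ)) := by
        funext α
        have := hpc univ α
        simpa using this
      rw [this]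
      exact Submodule.smul_mem _ _ (Submodule.subset_span Mono.empty)
    · have : t = 0 := by
        funext α
        exact (hne ⟨α⟩).elim
      rw [this]
      exact Submodule.zero_mem _
  · set M := Submodule.span ℂ {m : (ι → Fin N) → ℂ | Mono J S m} with hM
    have hDM : ∀ m ∈ M, jmOp S i m ∈ M := by
      have hperm : ∀ j ∈ S, ∀ m ∈ M, (fun α => m (α ∘ Equiv.swap i j)) ∈ M := by
        intro j hj m hm
        induction hm using Submodule.span_induction with
        | mem x hx =>
          refine Submodule.subset_span ?_
          have := Mono.perm hx (Equiv.swap i j)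
          have e : S.map (Equiv.swap i j).toEmbedding = S := by
            ext x
            rw [Finset.mem_map_equiv, Equiv.symm_swap, swap_mem_iff hi hj]
          rwa [e] at this
        | zero => exact Submodule.zero_mem _
        | add x y _ _ hx hy => exact Submodule.add_mem _ hx hy
        | smul c x _ hx => exact Submodule.smul_mem _ c hx
      intro m hm
      have : jmOp S i m = ((N : ℂ) + 1) • m +
          ∑ j ∈ S.erase i, (fun α => m (α ∘ Equiv.swap i j)) := by
        funext α
        simp [jmOp_apply]
      rw [this]
      exact Submodule.add_mem _ (Submodule.smul_mem _ _ hm)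
        (Submodule.sum_mem _ fun j hj => hperm j (mem_of_mem_erase hj) m hm)
    have hDt : jmOp S i t ∈ M := by
      rw [ht.casimir hJQ hQJ hi]
      refine Submodule.neg_mem _ (Submodule.sum_mem _ fun j hj => ?_)
      have hji := ne_of_mem_erase hj
      have hjS := mem_of_mem_erase hj
      have hc := ih #((S.erase i).erase j) (by
        rw [← hS]
        exact Finset.card_lt_card ((Finset.erase_subset _ _).trans_ssubset
          (Finset.erase_ssubset hi))) _ _ rfl (ht.contr hJ hJQ hQJ hi hjS hji)
      generalize SpFFT.contr Q i j t = s at hc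
      induction hc using Submodule.span_induction with
      | mem x hx =>
        refine Submodule.subset_span ?_
        have := Mono.step _ _ i j hji.symm (by simp) (by simp) hx
        rwa [Finset.insert_erase hj, Finset.insert_erase hi] at this
      | zero =>
        have : (fun α : ι → Fin N => J (α i) (α j) * (0 : (ι → Fin N) → ℂ) α) = 0 := by
          funext α; simp
        rw [this]
        exact Submodule.zero_mem _
      | add x y _ _ hx hy =>
        have : (fun α : ι → Fin N => J (α i) (α j) * (x + y) α) =
          (fun α => J (α i) (α j) * x α) + fun α => J (α i) (α j) * y α := by
          funext α; simp [mul_add]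
        rw [this]
        exact Submodule.add_mem _ hx hy
      | smul c x _ hx =>
        have : (fun α : ι → Fin N => J (α i) (α j) * (c • x) α) =
          c • (fun α => J (α i) (α j) * x α) := by
          funext α; simp; ring
        rw [this]
        exact Submodule.smul_mem _ c hx
    have hinj := jmOp_injective (N := N) S hi
    let D : M →ₗ[ℂ] M := (jmOp S i).restrict hDM
    have hDinj : Injective D := by
      intro x y hxy
      apply Subtype.ext
      apply hinj
      exact congrArg Subtype.val hxy
    have hDsurj : Surjective D := LinearMap.injective_iff_surjective.mp hDinj
    obtain ⟨m, hm⟩ := hDsurj ⟨_, hDt⟩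
    have : jmOp S i m.1 = jmOp S i t := congrArg Subtype.val hm
    rw [← hinj this]
    exact m.2

end SpFFT

namespace SpFFT

open Finset Function

lemma Mono.exists_involution {ι : Type*} [DecidableEq ι] {N : ℕ} {J : Matrix (Fin N) (Fin N) ℂ}
    {S : Finset ι} {m : (ι → Fin N) → ℂ} (h : Mono J S m) :
    ∃ (τ : ι → ι) (B : Finset ι), (∀ x, τ (τ x) = x) ∧ (∀ x, x ∈ S ↔ τ x ≠ x) ∧ B ⊆ S ∧
      (∀ x ∈ S, (x ∈ B ↔ τ x ∉ B)) ∧ ∀ α, m α = ∏ x ∈ B, J (α x) (α (τ x)) := by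
  induction h with
  | empty => exact ⟨id, ∅, by simp, by simp, by simp, by simp, by simp⟩
  | step S m i j hij hi hj hm ih =>
    obtain ⟨τ, B, h1, h2, h3, h4, h5⟩ := ih
    have ti : τ i = i := by
      by_contra hne; exact hi ((h2 i).mpr hne)
    have tj : τ j = j := by
      by_contra hne; exact hj ((h2 j).mpr hne)
    have hτi : ∀ x, x ≠ i → τ x ≠ i := by
      intro x hx he
      apply hx
      rw [← h1 x, he, ti]
    have hτj : ∀ x, x ≠ j → τ x ≠ j := by
      intro x hx he
      apply hx
      rw [← h1 x, he, tj]
    have hiB : i ∉ B := fun hh => hi (h3 hh)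
    have hjB : j ∉ B := fun hh => hj (h3 hh)
    refine ⟨fun x => if x = i then j else if x = j then i else τ x, insert i B, ?_, ?_, ?_, ?_, ?_⟩
    · intro x
      by_cases hxi : x = i
      · subst hxi; simp [hij.symm]
      by_cases hxj : x = j
      · subst hxj; simp [hij.symm]
      simp [hxi, hxj, hτi x hxi, hτj x hxj, h1]
    · intro x
      by_cases hxi : x = i
      · subst hxi; simp [hij.symm]
      by_cases hxj : x = j
      · subst hxj; simp [hij.symm, hij]
      simp [hxi, hxj, h2]
    · exact insert_subset_insert _ (h3.trans (subset_insert _ _))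
    · intro x hx
      by_cases hxi : x = i
      · subst hxi; simp [hij.symm, hjB]
      by_cases hxj : x = j
      · subst hxj; simp [hij.symm, hjB]
      have hxS : x ∈ S := by simpa [hxi, hxj] using hx
      simp [hxi, hxj, hτi x hxi, h4 x hxS]
    · intro α
      rw [prod_insert hiB]
      simp only [if_true, h5]
      congr 1
      refine prod_congr rfl fun x hx => ?_
      have hxi : x ≠ i := fun e => hiB (e ▸ hx)
      have hxj : x ≠ j := fun e => hjB (e ▸ hx)
      simp [hxi, hxj]

/-- Two fixed point free involutions admit a common 2-colouring. -/
lemma exists_coloring {ι : Type*} (ε τ : Equiv.Perm ι) (he : ∀ x, ε (ε x) = x)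
    (ht : ∀ x, τ (τ x) = x) (he' : ∀ x, ε x ≠ x) (ht' : ∀ x, τ x ≠ x) :
    ∃ χ : ι → Prop, (∀ x, χ (ε x) ↔ ¬ χ x) ∧ ∀ x, χ (τ x) ↔ ¬ χ x := by
  classical
  let ρ : Equiv.Perm ι := τ * ε
  have hεi : ε⁻¹ = ε := by
    ext x; rw [Equiv.Perm.inv_eq_iff_eq, he]
  have hτi : τ⁻¹ = τ := by
    ext x; rw [Equiv.Perm.inv_eq_iff_eq, ht]
  have hconj : ε * ρ * ε⁻¹ = ρ⁻¹ := by
    simp only [ρ, mul_inv_rev, hεi, hτi]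
    ext x; simp [he]
  have hconjz : ∀ (m : ℤ) x, ε ((ρ ^ m) x) = (ρ ^ (-m)) (ε x) := by
    intro m x
    have : ε * ρ ^ m * ε⁻¹ = ρ ^ (-m) := by
      rw [← conj_zpow, hconj, zpow_neg, inv_zpow]
    rw [← this]
    simp
  have hne : ∀ x, ¬ ρ.SameCycle x (ε x) := by
    rintro x ⟨m, hm⟩
    rcases Int.even_or_odd' m with ⟨l, rfl | rfl⟩
    · apply he' ((ρ ^ l) x)
      rw [hconjz, ← hm, ← Equiv.Perm.mul_apply, ← zpow_add]
      congr 2; ring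
    · apply ht' (ε ((ρ ^ l) x))
      have : τ (ε ((ρ ^ l) x)) = (ρ ^ (1 + l)) x := by
        rw [zpow_add, zpow_one]; rfl
      rw [this, hconjz, ← hm, ← Equiv.Perm.mul_apply, ← zpow_add]
      congr 2; ring
  let s : Setoid ι := Equiv.Perm.SameCycle.setoid ρ
  let q : ι → Quotient s := Quotient.mk s
  have hq : ∀ x, q (ε x) ≠ q x := fun x h => hne x (Quotient.exact h.symm)
  have hqt : ∀ x, q (τ x) = q (ε x) := by
    intro x
    refine Quotient.sound ?_
    refine Equiv.Perm.SameCycle.symm ⟨1, ?_⟩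
    simp [ρ, he]
  have hqet : ∀ x, q (ε (τ x)) = q x := by
    intro x
    refine Quotient.sound ?_
    refine ⟨1, ?_⟩
    simp [ρ, he, ht]
  let _ : LinearOrder (Quotient s) := linearOrderOfSTO WellOrderingRel
  have hχ : ∀ x, q (ε x) < q x ↔ ¬ q x < q (ε x) := by
    intro x
    rw [not_lt, le_iff_lt_or_eq, or_iff_left (hq x)]
  refine ⟨fun x => q x < q (ε x), ?_, ?_⟩
  · intro x
    simp only [he]
    exact hχ x
  · intro x
    simp only [hqt, hqet]
    exact hχ x

/-- Contraction of a matching monomial with symmetric matrices is a signed trace monomial. -/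
lemma Mono.contract {k N : ℕ} {J : Matrix (Fin N) (Fin N) ℂ} (hJ : ∀ a b, J a b = - J b a)
    {m : (Fin k × Bool → Fin N) → ℂ} (h : Mono J univ m) :
    ∃ (c : ℂ) (σ : Equiv.Perm (Fin k)), ∀ Y : Fin k → Matrix (Fin N) (Fin N) ℂ,
      (∀ i a b, Y i a b = Y i b a) →
      ∑ α, m α * ∏ i, Y i (α (i, false)) (α (i, true)) =
        c * ∑ j : Fin k → Fin N, ∏ i, (Y i * J) (j i) (j (σ i)) := by
  classical
  obtain ⟨τ, B, h1, h2, h3, h4, h5⟩ := h.exists_involution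
  have hinv : Function.Involutive τ := h1
  have hε : Function.Involutive (fun x : Fin k × Bool => (x.1, !x.2)) := by
    intro x; simp
  obtain ⟨χ, hχ1, hχ2⟩ := exists_coloring hε.toPerm hinv.toPerm hε hinv
    (by intro x hx
        have := congrArg Prod.snd hx
        simp at this) (fun x => (h2 x).mp (mem_univ x))
  replace hχ1 : ∀ i b, χ (i, !b) ↔ ¬ χ (i, b) := fun i b => hχ1 (i, b)
  replace hχ2 : ∀ x, χ (τ x) ↔ ¬ χ x := hχ2
  -- the start of each edge
  let st : Fin k → Bool := fun i => if χ (i, false) then false else true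
  have hst : ∀ i, χ (i, st i) := by
    intro i
    by_cases hc : χ (i, false)
    · simp [st, hc]
    · have := hχ1 i false
      simp only [Bool.not_false] at this
      simp [st, hc, this]
  have hst' : ∀ i, ¬ χ (i, !(st i)) := fun i => by rw [hχ1, not_not]; exact hst i
  have huniq : ∀ x : Fin k × Bool, χ x → x = (x.1, st x.1) := by
    rintro ⟨i, b⟩ hx
    by_contra hne
    have : b = !(st i) := by
      have : b ≠ st i := fun e => hne (by simp [e])
      revert this
      cases b <;> cases st i <;> simp
    exact hst' i (this ▸ hx)
  have huniq' : ∀ x : Fin k × Bool, ¬ χ x → x = (x.1, !(st x.1)) := by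
    rintro ⟨i, b⟩ hx
    by_contra hne
    have : b = st i := by
      have : b ≠ !(st i) := fun e => hne (by simp [e])
      revert this
      cases b <;> cases st i <;> simp
    exact hx (this ▸ hst i)
  let σf : Fin k → Fin k := fun i => (τ (i, !(st i))).1
  have hσf : ∀ i, τ (i, !(st i)) = (σf i, st (σf i)) := by
    intro i
    exact huniq _ ((hχ2 _).mpr (hst' i))
  have hσinj : Injective σf := by
    intro i i' hii
    have e : τ (i, !(st i)) = τ (i', !(st i')) := by rw [hσf, hσf, hii]
    exact congrArg Prod.fst (hinv.injective e)
  let σ : Equiv.Perm (Fin k) := Equiv.ofBijective σf (Finite.injective_iff_bijective.mp hσinj)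
  let c : ℂ := ∏ x ∈ B, if χ x then -1 else 1
  have hm : ∀ α, m α = c * ∏ i, J (α (i, !(st i))) (α (σ i, st (σ i))) := by
    intro α
    rw [h5]
    have e1 : ∏ x ∈ B, J (α x) (α (τ x)) = c * ∏ x ∈ B,
        (if χ x then J (α (τ x)) (α x) else J (α x) (α (τ x))) := by
      rw [← prod_mul_distrib]
      refine prod_congr rfl fun x _ => ?_
      split_ifs
      · rw [hJ]; ring
      · ring
    rw [e1]
    congr 1
    refine prod_bij' (fun x _ => if χ x then (τ x).1 else x.1)
      (fun i _ => if (i, !(st i)) ∈ B then (i, !(st i)) else τ (i, !(st i))) ?_ ?_ ?_ ?_ ?_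
    · intros; simp
    · intro i _
      split_ifs with hB
      · exact hB
      · by_contra hB'
        exact hB ((h4 _ (mem_univ _)).mpr hB')
    · intro x hx
      by_cases hc : χ x
      · have e : (((τ x).1, !(st (τ x).1)) : Fin k × Bool) = τ x :=
          (huniq' _ (by rw [hχ2]; exact not_not.mpr hc)).symm
        simp only [hc, if_true]
        rw [e, h1, if_neg ((h4 x (mem_univ x)).mp hx)]
      · have e := (huniq' x hc).symm
        simp only [hc, if_false]
        rw [e, if_pos hx]
    · intro i _
      by_cases hB : (i, !(st i)) ∈ B
      · simp only [hB, if_true]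
        rw [if_neg (hst' i)]
      · simp only [hB, if_false]
        rw [if_pos ((hχ2 _).mpr (hst' i)), h1]
    · intro x hx
      by_cases hc : χ x
      · have e : (((τ x).1, !(st (τ x).1)) : Fin k × Bool) = τ x :=
          (huniq' _ (by rw [hχ2]; exact not_not.mpr hc)).symm
        simp only [hc, if_true]
        have e2 := hσf (τ x).1
        rw [e, h1] at e2
        rw [e]
        change _ = J _ (α (σf (τ x).1, st (σf (τ x).1)))
        rw [← e2]
      · have e := (huniq' x hc).symm
        simp only [hc, if_false]
        have e2 := hσf x.1
        rw [e] at e2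
        rw [e]
        change _ = J _ (α (σf x.1, st (σf x.1)))
        rw [← e2]
  refine ⟨c, σ, fun Y hY => ?_⟩
  have hYst : ∀ α : Fin k × Bool → Fin N, ∀ i,
      Y i (α (i, false)) (α (i, true)) = Y i (α (i, st i)) (α (i, !(st i))) := by
    intro α i
    cases st i
    · rfl
    · exact hY _ _ _
  let E : ((Fin k → Fin N) × (Fin k → Fin N)) ≃ (Fin k × Bool → Fin N) :=
    { toFun := fun p x => if x.2 = st x.1 then p.1 x.1 else p.2 x.1
      invFun := fun α => (fun i => α (i, st i), fun i => α (i, !(st i)))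
      left_inv := by
        rintro ⟨p, q⟩
        simp
      right_inv := by
        intro α
        funext x
        obtain ⟨i, b⟩ := x
        by_cases hb : b = st i
        · simp [hb]
        · have : (!(st i)) = b := by
            revert hb
            cases b <;> cases st i <;> simp
          simp [hb, this] }
  rw [← E.sum_comp, Fintype.sum_prod_type, mul_sum]
  refine sum_congr rfl fun j _ => ?_
  have e1 : ∀ l : Fin k → Fin N, m (E (j, l)) * ∏ i, Y i (E (j, l) (i, false)) (E (j, l) (i, true)) =
      c * ∏ i, (Y i (j i) (l i) * J (l i) (j (σ i))) := by
    intro l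
    rw [hm, prod_congr rfl (fun i _ => hYst (E (j, l)) i), prod_mul_distrib]
    simp only [E, Equiv.coe_fn_mk, if_true]
    simp
    ring
  rw [sum_congr rfl (fun l _ => e1 l), ← mul_sum]
  congr 1
  simp only [Matrix.mul_apply]
  rw [Finset.prod_univ_sum]
  simp

end SpFFT

namespace SpFFT

open Finset Function

lemma std_transpose (r : ℕ) : (stdSymplecticMatrix r).transpose = -stdSymplecticMatrix r := by
  unfold stdSymplecticMatrix
  rw [Matrix.transpose_reindex, Matrix.fromBlocks_transpose]
  ext i j
  simp only [Matrix.reindex_apply, Matrix.submatrix_apply, Matrix.neg_apply]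
  rw [← Matrix.neg_apply, Matrix.fromBlocks_neg]
  simp

lemma std_sq (r : ℕ) : stdSymplecticMatrix r * stdSymplecticMatrix r = -1 := by
  unfold stdSymplecticMatrix
  rw [Matrix.reindex_apply, Matrix.submatrix_mul_equiv, Matrix.fromBlocks_multiply]
  simp only [mul_zero, zero_mul, mul_one, zero_add, add_zero, one_mul]
  have : (Matrix.fromBlocks (-1) 0 0 (-1) : Matrix (Fin r ⊕ Fin r) (Fin r ⊕ Fin r) ℂ) = -1 := by
    rw [← Matrix.fromBlocks_one, Matrix.fromBlocks_neg]
    simp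
  rw [this]
  ext i j
  simp [Matrix.one_apply]

lemma std_skew (r : ℕ) (a b : Fin (2 * r)) :
    stdSymplecticMatrix r a b = - stdSymplecticMatrix r b a := by
  have := congrFun (congrFun (std_transpose r) b) a
  simpa using this

lemma std_mul_neg (r : ℕ) : stdSymplecticMatrix r * (-stdSymplecticMatrix r) = 1 := by
  rw [mul_neg, std_sq, neg_neg]

lemma neg_mul_std (r : ℕ) : (-stdSymplecticMatrix r) * stdSymplecticMatrix r = 1 := by
  rw [neg_mul, std_sq, neg_neg]

lemma mem_sp {r : ℕ} {X : Matrix (Fin (2 * r)) (Fin (2 * r)) ℂ} :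
    X ∈ spSubmodule r ↔ X.transpose * stdSymplecticMatrix r = -(stdSymplecticMatrix r * X) :=
  Iff.rfl

lemma sym_mul_mem {r : ℕ} {P : Matrix (Fin (2 * r)) (Fin (2 * r)) ℂ} (h : P.transpose = P) :
    P * stdSymplecticMatrix r ∈ spSubmodule r := by
  rw [mem_sp, Matrix.transpose_mul, h, std_transpose]
  simp [mul_assoc]

lemma triple_mem {r : ℕ} {A X : Matrix (Fin (2 * r)) (Fin (2 * r)) ℂ} (hA : A ∈ spSubmodule r)
    (hX : X ∈ spSubmodule r) : A * X * A ∈ spSubmodule r := by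
  rw [mem_sp] at *
  rw [Matrix.transpose_mul, Matrix.transpose_mul, mul_assoc, mul_assoc, hA, mul_neg,
    ← mul_assoc X.transpose, hX, neg_mul, neg_neg, ← mul_assoc, ← mul_assoc, hA]
  simp [mul_assoc]

lemma brk_mem {r : ℕ} {A X : Matrix (Fin (2 * r)) (Fin (2 * r)) ℂ} (hA : A ∈ spSubmodule r)
    (hX : X ∈ spSubmodule r) : A * X - X * A ∈ spSubmodule r := by
  rw [mem_sp] at *
  rw [Matrix.transpose_sub, Matrix.transpose_mul, Matrix.transpose_mul, sub_mul, mul_assoc, hA,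
    mul_assoc, hX, mul_neg, mul_neg, ← mul_assoc, hX, ← mul_assoc, hA, mul_sub]
  simp only [neg_mul, neg_neg, mul_assoc]
  abel

/-- Lie bracket on the symplectic Lie algebra. -/
noncomputable def brk {r : ℕ} (A X : spSubmodule r) : spSubmodule r :=
  ⟨A.1 * X.1 - X.1 * A.1, brk_mem A.2 X.2⟩

lemma multilinear_continuous {k n : ℕ}
    (g : MultilinearMap ℂ (fun _ : Fin k => (Fin n → ℂ)) ℂ) : Continuous g := by
  have : (g : (Fin k → Fin n → ℂ) → ℂ) = fun c => ∑ φ : Fin k → Fin n,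
      (∏ i, c i (φ i)) * g (fun i => Pi.single (φ i) 1) := by
    funext c
    have hc : c = fun i => ∑ l, c i l • (Pi.single l (1 : ℂ) : Fin n → ℂ) := by
      funext i
      exact pi_eq_sum_univ' (c i)
    conv_lhs => rw [hc]
    rw [g.map_sum]
    refine sum_congr rfl fun φ _ => ?_
    rw [g.map_smul_univ]
    rfl
  rw [this]
  fun_prop

lemma multilinear_deriv {k : ℕ} {E : Type*} [AddCommGroup E] [Module ℂ E]
    (f : MultilinearMap ℂ (fun _ : Fin k => E) ℂ) (X U W : Fin k → E)
    (h : ∀ s : ℂ, f (fun i => X i + s • U i + s ^ 2 • W i) = f X) :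
    ∑ i, f (update X i (U i)) = 0 := by
  let ℓ : Fin k → (Fin 3 → ℂ) →ₗ[ℂ] E := fun i =>
    (LinearMap.proj 0).smulRight (X i) + (LinearMap.proj 1).smulRight (U i) +
      (LinearMap.proj 2).smulRight (W i)
  have hℓ : ∀ i c, ℓ i c = c 0 • X i + c 1 • U i + c 2 • W i := fun i c => rfl
  let g : ContinuousMultilinearMap ℂ (fun _ : Fin k => (Fin 3 → ℂ)) ℂ :=
    ⟨f.compLinearMap ℓ, multilinear_continuous _⟩
  have hg : ∀ c, g c = f (fun i => ℓ i (c i)) := fun c => rfl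
  let γ : ℂ → (Fin k → Fin 3 → ℂ) := fun s _ => ![1, s, s ^ 2]
  have hγ : HasDerivAt γ (fun _ => ![0, 1, 0]) 0 := by
    rw [hasDerivAt_pi]
    intro i
    rw [hasDerivAt_pi]
    intro l
    fin_cases l
    · exact hasDerivAt_const _ _
    · exact hasDerivAt_id _
    · have h2 : HasDerivAt (fun s : ℂ => s ^ 2) 0 0 := by
        simpa using hasDerivAt_pow 2 (0 : ℂ)
      exact h2
  have h1 := (g.hasFDerivAt (γ 0)).comp_hasDerivAt (0 : ℂ) hγ
  have h2 : (g ∘ γ) = fun _ => f X := by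
    funext s
    rw [comp_apply, hg, ← h s]
    congr 1
    funext i
    simp [hℓ, γ]
  rw [h2] at h1
  have h3 := h1.unique (hasDerivAt_const _ _)
  rw [ContinuousMultilinearMap.linearDeriv_apply] at h3
  rw [← h3]
  refine sum_congr rfl fun i _ => ?_
  rw [hg]
  congr 1
  funext j
  by_cases hj : j = i
  · subst hj; simp [hℓ]
  · simp [hℓ, hj, γ]

section

variable {r k : ℕ} (f : MultilinearMap ℂ (fun _ : Fin k => ↥(spSubmodule r)) ℂ)

lemma lie_inv_of_sq
    (hf : ∀ S : Matrix (Fin (2 * r)) (Fin (2 * r)) ℂ,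
      S.transpose * stdSymplecticMatrix r * S = stdSymplecticMatrix r →
      ∀ X Y : Fin k → ↥(spSubmodule r),
        (∀ i, (Y i : Matrix (Fin (2 * r)) (Fin (2 * r)) ℂ)
            = S * (X i : Matrix (Fin (2 * r)) (Fin (2 * r)) ℂ) * S⁻¹) →
        f Y = f X)
    (A : spSubmodule r) (hA : A.1 * A.1 = 0) (X : Fin k → spSubmodule r) :
    ∑ i, f (update X i (brk A (X i))) = 0 := by
  refine multilinear_deriv f X (fun i => brk A (X i))
    (fun i => -⟨A.1 * (X i).1 * A.1, triple_mem A.2 (X i).2⟩) ?_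
  intro s
  have hinv : (1 + s • A.1) * (1 - s • A.1) = 1 := by
    simp [mul_sub, add_mul, hA]
  refine hf (1 + s • A.1) ?_ X _ ?_
  · have hAm := mem_sp.mp A.2
    rw [Matrix.transpose_add, Matrix.transpose_one, Matrix.transpose_smul, add_mul, one_mul,
      smul_mul_assoc, hAm]
    simp [mul_add, add_mul, mul_assoc, hA]
  · intro i
    rw [Matrix.inv_eq_right_inv hinv]
    simp only [brk, Submodule.coe_add, Submodule.coe_smul, Submodule.coe_neg]
    simp only [mul_sub, add_mul, mul_one, one_mul, smul_mul_assoc, mul_smul_comm, smul_sub,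
      smul_neg, smul_add, smul_smul, pow_two]
    abel

/-- Symmetrised elementary symmetric matrix times the symplectic form. -/
noncomputable def Zel (r : ℕ) (a b : Fin (2 * r)) : spSubmodule r :=
  ⟨((1 / 2 : ℂ) • (Matrix.single a b 1 + Matrix.single b a 1)) * stdSymplecticMatrix r,
    sym_mul_mem (by simp [Matrix.transpose_add, add_comm])⟩

lemma lie_inv
    (hf : ∀ S : Matrix (Fin (2 * r)) (Fin (2 * r)) ℂ,
      S.transpose * stdSymplecticMatrix r * S = stdSymplecticMatrix r →
      ∀ X Y : Fin k → ↥(spSubmodule r),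
        (∀ i, (Y i : Matrix (Fin (2 * r)) (Fin (2 * r)) ℂ)
            = S * (X i : Matrix (Fin (2 * r)) (Fin (2 * r)) ℂ) * S⁻¹) →
        f Y = f X)
   (a b : Fin (2 * r)) (X : Fin k → spSubmodule r) :
    ∑ i, f (update X i (brk ((2 : ℂ) • Zel r a b) (X i))) = 0 := by
  have hJ := std_skew r
  have hJd : ∀ a, stdSymplecticMatrix r a a = 0 := by
    intro a
    have := hJ a a
    linear_combination (1 / 2 : ℂ) * this
  have hsq : ∀ a, (Matrix.single a a (1 : ℂ) * stdSymplecticMatrix r) *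
      (Matrix.single a a (1 : ℂ) * stdSymplecticMatrix r) = 0 := by
    intro a
    rw [← mul_assoc, Matrix.single_mul_mul_single, hJd]
    simp
  let A1 : Fin (2 * r) → spSubmodule r := fun a =>
    ⟨Matrix.single a a (1 : ℂ) * stdSymplecticMatrix r, sym_mul_mem (by simp)⟩
  let A3 : spSubmodule r :=
    ⟨(Matrix.single a a (1 : ℂ) + Matrix.single b b 1 + Matrix.single a b 1 + Matrix.single b a 1)
      * stdSymplecticMatrix r, sym_mul_mem (by simp [Matrix.transpose_add]; abel)⟩
  have h3 : A3.1 * A3.1 = 0 := by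
    simp only [A3]
    rw [← mul_assoc]
    simp only [add_mul, mul_add, Matrix.single_mul_mul_single, hJd, one_mul, mul_one]
    rw [hJ b a]
    simp only [← add_mul]
    have : ∀ x y : Fin (2 * r), ∀ c : ℂ, Matrix.single x y (-c) = - Matrix.single x y c := by
      intro x y c
      ext i j
      simp only [Matrix.single_apply, Matrix.neg_apply]
      split_ifs <;> simp
    simp only [this, Matrix.single_zero]
    convert zero_mul _ using 2
    abel
  have e : ∀ Y : spSubmodule r, brk ((2 : ℂ) • Zel r a b) Y =
      brk A3 Y - brk (A1 a) Y - brk (A1 b) Y := by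
    intro Y
    apply Subtype.ext
    simp only [brk, Zel, A3, A1, Submodule.coe_sub, Submodule.coe_smul, smul_mul_assoc, smul_smul]
    norm_num
    simp only [add_mul, mul_add]
    abel
  have l1 := lie_inv_of_sq f hf (A1 a) (hsq a) X
  have l2 := lie_inv_of_sq f hf (A1 b) (hsq b) X
  have l3 := lie_inv_of_sq f hf A3 h3 X
  simp only [e, MultilinearMap.map_update_sub, sum_sub_distrib, l1, l2, l3]
  simp

lemma brk_Zel (a b p q : Fin (2 * r)) : brk ((2 : ℂ) • Zel r a b) (Zel r p q) =
    stdSymplecticMatrix r b p • Zel r a q + stdSymplecticMatrix r a p • Zel r b q +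
    (stdSymplecticMatrix r b q • Zel r p a + stdSymplecticMatrix r a q • Zel r p b) := by
  have hJ := std_skew r
  apply Subtype.ext
  simp only [brk, Zel, Submodule.coe_add, Submodule.coe_smul, smul_mul_assoc, mul_smul_comm,
    ← mul_assoc, smul_smul]
  norm_num
  simp only [add_mul, mul_add, Matrix.single_mul_mul_single, one_mul, mul_one, smul_add]
  rw [hJ q a, hJ q b, hJ p a, hJ p b]
  have e1 : ∀ x y : Fin (2 * r), ∀ c : ℂ, Matrix.single x y (-c) =
      - (c • Matrix.single x y (1 : ℂ)) := by
    intro x y c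
    ext i j
    simp only [Matrix.single_apply, Matrix.neg_apply, Matrix.smul_apply, smul_eq_mul]
    split_ifs <;> simp
  have e2 : ∀ x y u v : Fin (2 * r), Matrix.single x y (stdSymplecticMatrix r u v) =
      (stdSymplecticMatrix r u v) • Matrix.single x y (1 : ℂ) := by
    intro x y u v
    ext i j
    simp [Matrix.single_apply]
  simp only [e1, e2, neg_mul, smul_mul_assoc, smul_neg]
  module

/-- The coefficient array of `f`. -/
noncomputable def coeffs (α : Fin k × Bool → Fin (2 * r)) : ℂ :=
  f (fun i => Zel r (α (i, false)) (α (i, true)))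

lemma coeffs_inv
    (hf : ∀ S : Matrix (Fin (2 * r)) (Fin (2 * r)) ℂ,
      S.transpose * stdSymplecticMatrix r * S = stdSymplecticMatrix r →
      ∀ X Y : Fin k → ↥(spSubmodule r),
        (∀ i, (Y i : Matrix (Fin (2 * r)) (Fin (2 * r)) ℂ)
            = S * (X i : Matrix (Fin (2 * r)) (Fin (2 * r)) ℂ) * S⁻¹) →
        f Y = f X)
    : Inv (stdSymplecticMatrix r) univ (coeffs f) := by
  constructor
  · intro i hi
    exact absurd (mem_univ i) hi
  · intro α a b
    have key := lie_inv f hf a b (fun i => Zel r (α (i, false)) (α (i, true)))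
    simp only [brk_Zel, MultilinearMap.map_update_add, MultilinearMap.map_update_smul] at key
    rw [← key, Fintype.sum_prod_type]
    refine sum_congr rfl fun i _ => ?_
    have u1 : ∀ c, coeffs f (update α (i, false) c) =
        f (update (fun i => Zel r (α (i, false)) (α (i, true))) i (Zel r c (α (i, true)))) := by
      intro c
      unfold coeffs
      congr 1
      funext j
      by_cases hj : j = i
      · subst hj; simp
      · simp [hj]
    have u2 : ∀ c, coeffs f (update α (i, true) c) =
        f (update (fun i => Zel r (α (i, false)) (α (i, true))) i (Zel r (α (i, false)) c)) := by
      intro c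
      unfold coeffs
      congr 1
      funext j
      by_cases hj : j = i
      · subst hj; simp
      · simp [hj]
    rw [Fintype.sum_bool, u1, u1, u2, u2]
    simp only [smul_eq_mul]
    ring

lemma Y_symm (X : spSubmodule r) (a b : Fin (2 * r)) :
    (X.1 * (-stdSymplecticMatrix r)) a b = (X.1 * (-stdSymplecticMatrix r)) b a := by
  have h : (X.1 * (-stdSymplecticMatrix r)).transpose = X.1 * (-stdSymplecticMatrix r) := by
    rw [Matrix.transpose_mul, Matrix.transpose_neg, std_transpose, neg_neg]
    have h := mem_sp.mp X.2
    calc _ = stdSymplecticMatrix r * (X.1.transpose * (stdSymplecticMatrix r *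
          (-stdSymplecticMatrix r))) := by rw [std_mul_neg, mul_one]
      _ = stdSymplecticMatrix r * ((X.1.transpose * stdSymplecticMatrix r) *
          (-stdSymplecticMatrix r)) := by rw [mul_assoc]
      _ = ((-stdSymplecticMatrix r) * stdSymplecticMatrix r) * X.1 *
          (-stdSymplecticMatrix r) := by rw [h]; simp [mul_assoc]
      _ = _ := by rw [neg_mul_std, one_mul]
  exact (congrFun (congrFun h a) b).symm

lemma sp_expand (X : spSubmodule r) : X = ∑ p : Fin (2 * r) × Fin (2 * r),
    (X.1 * (-stdSymplecticMatrix r)) p.1 p.2 • Zel r p.1 p.2 := by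
  have hs := Y_symm X
  have hX : X.1 = (X.1 * (-stdSymplecticMatrix r)) * stdSymplecticMatrix r := by
    rw [mul_assoc, neg_mul_std, mul_one]
  generalize hY : X.1 * (-stdSymplecticMatrix r) = Y at *
  apply Subtype.ext
  rw [hX]
  simp only [Submodule.coe_sum, Submodule.coe_smul, Zel, ← smul_mul_assoc]
  rw [← Finset.sum_mul]
  congr 1
  simp only [smul_add, sum_add_distrib, Fintype.sum_prod_type]
  have e1 : ∑ x, ∑ y, Y x y • (1 / 2 : ℂ) • Matrix.single x y (1 : ℂ) = (1 / 2 : ℂ) • Y := by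
    conv_rhs => rw [Matrix.matrix_eq_sum_single Y]
    simp [smul_sum, Matrix.smul_single, mul_comm]
  have e2 : ∑ x, ∑ y, Y x y • (1 / 2 : ℂ) • Matrix.single y x (1 : ℂ) = (1 / 2 : ℂ) • Y := by
    rw [sum_comm, ← e1]
    exact sum_congr rfl fun x _ => sum_congr rfl fun y _ => by rw [hs]
  rw [e1, e2, ← add_smul]
  norm_num

lemma f_expand (X : Fin k → spSubmodule r) :
    f X = ∑ α : Fin k × Bool → Fin (2 * r), coeffs f α *
      ∏ i, ((X i).1 * (-stdSymplecticMatrix r)) (α (i, false)) (α (i, true)) := by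
  have hX : X = fun i => ∑ p : Fin (2 * r) × Fin (2 * r),
    ((X i).1 * (-stdSymplecticMatrix r)) p.1 p.2 • Zel r p.1 p.2 := by
    funext i; exact sp_expand (X i)
  conv_lhs => rw [hX]
  rw [f.map_sum]
  let E : (Fin k → Fin (2 * r) × Fin (2 * r)) ≃ (Fin k × Bool → Fin (2 * r)) :=
    { toFun := fun φ x => if x.2 then (φ x.1).2 else (φ x.1).1
      invFun := fun α i => (α (i, false), α (i, true))
      left_inv := by intro φ; simp
      right_inv := by
        intro α
        funext ⟨i, b⟩
        cases b <;> simp }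
  rw [← E.sum_comp]
  refine sum_congr rfl fun φ _ => ?_
  rw [f.map_smul_univ, smul_eq_mul, mul_comm]
  simp [coeffs, E]

end

theorem main (r k : ℕ)
    (f : MultilinearMap ℂ (fun _ : Fin k => ↥(spSubmodule r)) ℂ)
    (hf : ∀ S : Matrix (Fin (2 * r)) (Fin (2 * r)) ℂ,
      S.transpose * stdSymplecticMatrix r * S = stdSymplecticMatrix r →
      ∀ X Y : Fin k → ↥(spSubmodule r),
        (∀ i, (Y i : Matrix (Fin (2 * r)) (Fin (2 * r)) ℂ)
            = S * (X i : Matrix (Fin (2 * r)) (Fin (2 * r)) ℂ) * S⁻¹) →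
        f Y = f X) :
    ⇑f ∈ Submodule.span ℂ
      {h : (Fin k → ↥(spSubmodule r)) → ℂ |
        ∃ σ : Equiv.Perm (Fin k),
          h = fun X => ∑ j : Fin k → Fin (2 * r), ∏ i : Fin k,
            (X i : Matrix (Fin (2 * r)) (Fin (2 * r)) ℂ) (j i) (j (σ i))} := by
  have hmem := fft (std_skew r) (std_mul_neg r) (neg_mul_std r) _ univ (coeffs f) rfl
    (coeffs_inv f hf)
  have hfe : (⇑f : (Fin k → ↥(spSubmodule r)) → ℂ) = fun X =>
      ∑ α : Fin k × Bool → Fin (2 * r), coeffs f α *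
      ∏ i, ((X i).1 * (-stdSymplecticMatrix r)) (α (i, false)) (α (i, true)) := by
    funext X; exact f_expand f X
  rw [hfe]
  generalize coeffs f = t at hmem
  induction hmem using Submodule.span_induction with
  | mem m hm =>
    obtain ⟨c, σ, h⟩ := Mono.contract (std_skew r) hm
    have : (fun X : Fin k → ↥(spSubmodule r) =>
      ∑ α : Fin k × Bool → Fin (2 * r), m α *
      ∏ i, ((X i).1 * (-stdSymplecticMatrix r)) (α (i, false)) (α (i, true))) =
      c • fun X : Fin k → ↥(spSubmodule r) => ∑ j : Fin k → Fin (2 * r), ∏ i : Fin k,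
            (X i : Matrix (Fin (2 * r)) (Fin (2 * r)) ℂ) (j i) (j (σ i)) := by
      funext X
      rw [h (fun i => (X i).1 * (-stdSymplecticMatrix r)) (fun i => Y_symm (X i))]
      simp only [mul_assoc (X _).1, neg_mul_std, mul_one, Pi.smul_apply, smul_eq_mul]
    rw [this]
    exact Submodule.smul_mem _ _ (Submodule.subset_span ⟨σ, rfl⟩)
  | zero =>
    convert Submodule.zero_mem _
    simp
  | add x y _ _ hx hy =>
    convert Submodule.add_mem _ hx hy using 1
    funext X
    simp [add_mul, sum_add_distrib]
  | smul c x _ hx =>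
    convert Submodule.smul_mem _ c hx using 1
    funext X
    simp [mul_sum, mul_assoc]

end SpFFT

theorem invariant_multilinear_sp_mem_span_trace_monomials
    (r k : ℕ) (hr : 1 ≤ r)
    (f : MultilinearMap ℂ (fun _ : Fin k => ↥(spSubmodule r)) ℂ)
    (hf : ∀ S : Matrix (Fin (2 * r)) (Fin (2 * r)) ℂ,
      S.transpose * stdSymplecticMatrix r * S = stdSymplecticMatrix r →
      ∀ X Y : Fin k → ↥(spSubmodule r),
        (∀ i, (Y i : Matrix (Fin (2 * r)) (Fin (2 * r)) ℂ)
            = S * (X i : Matrix (Fin (2 * r)) (Fin (2 * r)) ℂ) * S⁻¹) →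
        f Y = f X) :
    ⇑f ∈ Submodule.span ℂ
      {h : (Fin k → ↥(spSubmodule r)) → ℂ |
        ∃ σ : Equiv.Perm (Fin k),
          h = fun X => ∑ j : Fin k → Fin (2 * r), ∏ i : Fin k,
            (X i : Matrix (Fin (2 * r)) (Fin (2 * r)) ℂ) (j i) (j (σ i))} := by
  exact SpFFT.main r k f hf
end
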